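/- arXiv:math/0601380 — 10 statements merged into one kernel-verified Lean document; each statement's English description precedes it below -/
import Mathlib

section
/- Let F ⊆ E be fields of characteristic p > 0 such that E = F(c_1, …, c_n) where c_i^p ∈ F for all i ≤ n. Let 𝔏 denote the set of all E-subspaces L of the space Der_F(E) of F-linear derivations of E which are closed under the commutator bracket and closed under p-th powers (i.e. if D ∈ L then the p-fold composite D^p, which is again an F-linear derivation of E, lies in L). For L ∈ 𝔏 let E^L = {α ∈ E : D(α) = 0 for all D ∈ L}, an intermediate field of E/F. Then the map L ↦ E^L is an order-reversing bijection from 𝔏 onto the set of all intermediate fields of E/F: it is injective, every intermediate field F ⊆ K ⊆ E equals E^L for some L ∈ 𝔏, and for L₁, L₂ ∈ 𝔏 one has L₁ ⊆ L₂ if and only if E^{L₂} ⊆ E^{L₁}. -/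
open Finset in
/-- The general Leibniz rule for the iterates of a derivation. -/
theorem Derivation.iterate_apply_mul {R A : Type*} [CommSemiring R] [CommSemiring A] [Algebra R A]
    (D : Derivation R A A) (n : ℕ) (a b : A) :
    D^[n] (a * b) = ∑ ij ∈ antidiagonal n, n.choose ij.1 • (D^[ij.1] a * D^[ij.2] b) := by
  induction n with
  | zero => simp
  | succ n ih =>
    rw [sum_antidiagonal_choose_succ_nsmul (M := A) (fun i j => D^[i] a * D^[j] b) n]
    simp only [Function.iterate_succ_apply', ih, map_sum, map_nsmul, D.leibniz, smul_add,
      sum_add_distrib, smul_eq_mul]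
    refine congrArg₂ _ rfl (sum_congr rfl fun ⟨i, j⟩ hij ↦ ?_)
    rw [n.choose_symm_of_eq_add (mem_antidiagonal.1 hij).symm, mul_comm]

/-- In characteristic `p`, the `p`-fold composite of a derivation is a derivation. -/
theorem Derivation.exists_coe_eq_iterate {R A : Type*} [CommRing R] [CommRing A] [Algebra R A]
    (p : ℕ) (hp : p.Prime) [CharP A p] (D : Derivation R A A) :
    ∃ D' : Derivation R A A, ⇑D' = D^[p] := by
  have hcoe : ⇑((D : A →ₗ[R] A) ^ p) = D^[p] := by
    rw [Module.End.coe_pow]; rfl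
  refine ⟨Derivation.mk' ((D : A →ₗ[R] A) ^ p) fun a b => ?_, hcoe⟩
  rw [hcoe, D.iterate_apply_mul, Finset.Nat.sum_antidiagonal_eq_sum_range_succ_mk,
    Finset.sum_range_succ, ← Nat.sub_one_add_one hp.ne_zero, Finset.sum_range_succ']
  rw [Finset.sum_eq_zero]
  · simp [mul_comm b]
  · intro i hi
    rw [Finset.mem_range] at hi
    rw [Nat.sub_one_add_one hp.ne_zero, ← Nat.cast_smul_eq_nsmul A,
      (CharP.cast_eq_zero_iff A p _).2 (hp.dvd_choose_self i.succ_ne_zero (by omega)), zero_smul]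

theorem Derivation.iterate_pow_mul_of_eq_one {R A : Type*} [CommRing R] [CommRing A] [Algebra R A]
    (D : Derivation R A A) {a : A} (ha : D a = 1) (k : ℕ) {y : A} (hy : D y = 0) :
    D^[k] (a ^ k * y) = k.factorial * y := by
  induction k generalizing y with
  | zero => simp
  | succ k ih =>
    have h : D (a ^ (k + 1) * y) = a ^ k * ((k + 1 : ℕ) * y) := by
      simp only [D.leibniz, D.leibniz_pow, ha, hy, smul_eq_mul, nsmul_eq_mul, Nat.add_sub_cancel]
      ring
    rw [Function.iterate_succ_apply, h, ih (by simp [hy]), Nat.factorial_succ]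
    push_cast
    ring

/-- If commuting derivations `D i` of exponent `p` satisfy `D i (a j) = δ i j`, then the algebra
is generated by the `a i` over the common kernel of the `D i`. -/
theorem Derivation.mem_adjoin_of_apply_eq_ite {F A ι : Type*} [Field F] [CommRing A] [Algebra F A]
    [Fintype ι] [DecidableEq ι] (p : ℕ) (hp : p.Prime) [CharP F p]
    (D : ι → Derivation F A A) (a : ι → A)
    (hDa : ∀ i j, D i (a j) = if i = j then 1 else 0)
    (hcomm : ∀ i j x, D i (D j x) = D j (D i x))
    (hpow : ∀ i x, (D i)^[p] x = 0) (x : A) :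
    x ∈ Algebra.adjoin F ({x | ∀ i, D i x = 0} ∪ Set.range a) := by
  set S := Algebra.adjoin F ({x | ∀ i, D i x = 0} ∪ Set.range a)
  suffices H : ∀ T : Finset ι, ∀ x, (∀ i ∉ T, D i x = 0) → x ∈ S from
    H Finset.univ x (by simp)
  intro T
  induction T using Finset.induction_on with
  | empty => exact fun x hx => Algebra.subset_adjoin (Or.inl fun i => hx i (Finset.notMem_empty i))
  | insert i T hi ih =>
    intro x hx
    suffices H : ∀ k ≤ p, ∀ x, (∀ j ∉ insert i T, D j x = 0) → (D i)^[k] x = 0 → x ∈ S from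
      H p le_rfl x hx (hpow i x)
    intro k
    induction k with
    | zero =>
      intro _ x _ h
      rw [show x = 0 from h]
      exact S.zero_mem
    | succ k ihk =>
      intro hk x hx hxk
      have hiter : ∀ j ∉ insert i T, D j ((D i)^[k] x) = 0 := fun j hj => by
        rw [(Function.Commute.iterate_right (f := D j) (g := D i) (hcomm j i) k) x, hx j hj,
          iterate_map_zero]
      have hfac : (k.factorial : F) ≠ 0 := by
        rw [Ne, CharP.cast_eq_zero_iff F p, hp.dvd_factorial]
        omega
      set y := (k.factorial : F)⁻¹ • (D i)^[k] x with hy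
      have hyi : D i y = 0 := by
        rw [hy, map_smul, ← Function.iterate_succ_apply' (D i) k x, hxk, smul_zero]
      have hyj : ∀ j ∉ insert i T, D j y = 0 := fun j hj => by
        rw [hy, map_smul, hiter j hj, smul_zero]
      have hyS : y ∈ S := ih y fun j hj => by
        by_cases hji : j = i
        · rw [hji, hyi]
        · exact hyj j (by simp [hji, hj])
      have haS : a i ^ k * y ∈ S :=
        S.mul_mem (S.pow_mem (Algebra.subset_adjoin (Or.inr ⟨i, rfl⟩)) k) hyS
      have hsub : x - a i ^ k * y ∈ S := by
        refine ihk (by omega) _ (fun j hj => ?_) ?_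
        · have hji : j ≠ i := fun h => hj (by simp [h])
          simp [hx j hj, hyj j hj, hDa, hji, D j |>.leibniz_pow]
        · rw [iterate_map_sub, (D i).iterate_pow_mul_of_eq_one (by simp [hDa]) k hyi, hy,
            ← _root_.map_natCast (algebraMap F A), ← Algebra.smul_def, smul_inv_smul₀ hfac, sub_self]
      simpa using S.add_mem hsub haS

/-- A finite-dimensional space of derivations has a basis dual to evaluation at finitely many
elements. -/
theorem Derivation.exists_dual_family {F E : Type*} [Field F] [Field E] [Algebra F E]
    (L : Submodule E (Derivation F E E)) [FiniteDimensional E L] :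
    ∃ (m : ℕ) (D : Fin m → Derivation F E E) (a : Fin m → E), (∀ i, D i ∈ L) ∧
      (∀ i j, D i (a j) = if i = j then 1 else 0) ∧
      ∀ D' ∈ L, (∀ i, D' (a i) = 0) → D' = 0 := by
  let ev : E → Module.Dual E L := fun x =>
    { toFun := fun D => (D : Derivation F E E) x
      map_add' := fun _ _ => rfl
      map_smul' := fun _ _ => rfl }
  have hspan : Submodule.span E (Set.range ev) = ⊤ := by
    suffices h : (Submodule.span E (Set.range ev)).dualCoannihilator = ⊥ by
      rw [← Subspace.dualCoannihilator_dualAnnihilator_eq (W := Submodule.span E (Set.range ev)),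
        h, Submodule.dualAnnihilator_bot]
    rw [eq_bot_iff]
    intro D hD
    rw [Submodule.mem_dualCoannihilator] at hD
    exact Subtype.ext (Derivation.ext fun x => hD (ev x) (Submodule.subset_span ⟨x, rfl⟩))
  obtain ⟨κ, a, -, hs, hli⟩ := exists_linearIndependent' E ev
  let b : Module.Basis κ E (Module.Dual E L) := Module.Basis.mk hli (by rw [hs, hspan])
  have : Finite κ := Module.Finite.finite_basis b
  have : Fintype κ := Fintype.ofFinite κ
  let b' := b.reindex (Fintype.equivFin κ)
  have hb' : ∀ i, b' i = ev (a ((Fintype.equivFin κ).symm i)) := fun i => by simp [b', b]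
  let D := fun i => (Module.evalEquiv E L).symm (b'.dualBasis i)
  refine ⟨_, fun i => (D i : L), fun i => a ((Fintype.equivFin κ).symm i), fun i => (D i).2,
    fun i j => ?_, fun D' hD' h => ?_⟩
  · change ev _ (D i) = _
    rw [← hb']
    simp only [D, Module.apply_evalEquiv_symm_apply]
    rw [Module.Basis.dualBasis_apply_self]
    simp [eq_comm]
  · have : (Module.Dual.eval E L ⟨D', hD'⟩) = 0 := b'.ext fun i => by
      rw [hb']; exact h i
    have := (Module.forall_dual_apply_eq_zero_iff E (⟨D', hD'⟩ : L)).1 fun f =>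
      LinearMap.congr_fun this f
    exact congrArg Subtype.val this

/-- A finite-dimensional space of derivations closed under brackets and `p`-th powers contains
every derivation vanishing on its field of constants. -/
theorem Derivation.mem_of_forall_constant {F E : Type*} [Field F] [Field E] [Algebra F E]
    (p : ℕ) (hp : p.Prime) [CharP E p]
    (L : Submodule E (Derivation F E E)) [FiniteDimensional E L]
    (hlie : ∀ D₁ ∈ L, ∀ D₂ ∈ L, ⁅D₁, D₂⁆ ∈ L)
    (hpow : ∀ D ∈ L, ∀ D' : Derivation F E E, ⇑D' = (⇑D)^[p] → D' ∈ L)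
    (D : Derivation F E E) (hD : ∀ x, (∀ D' ∈ L, D' x = 0) → D x = 0) : D ∈ L := by
  obtain ⟨m, d, a, hdL, hda, hzero⟩ := Derivation.exists_dual_family L
  have : CharP F p := (algebraMap F E).charP (algebraMap F E).injective p
  have hsum : ∀ D' : Derivation F E E, ∀ x, (∑ i, D' (a i) • d i) x = ∑ i, D' (a i) * d i x :=
    fun D' x => by
      rw [← Derivation.coeFnAddMonoidHom_apply, map_sum, Finset.sum_apply]
      rfl
  have hsum_a : ∀ D' : Derivation F E E, ∀ j, (D' - ∑ i, D' (a i) • d i) (a j) = 0 :=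
    fun D' j => by simp [hsum, hda]
  have hsumL : ∀ D' : Derivation F E E, ∑ i, D' (a i) • d i ∈ L := fun D' =>
    L.sum_mem fun i _ => L.smul_mem _ (hdL i)
  have hconst : ∀ x, (∀ i, d i x = 0) → ∀ D' ∈ L, D' x = 0 := fun x hx D' hD' => by
    have h := hzero _ (L.sub_mem hD' (hsumL D')) (hsum_a D')
    rw [sub_eq_zero.1 h, hsum]
    simp [hx]
  have hcomm : ∀ i j x, d i (d j x) = d j (d i x) := fun i j x => by
    have h : ⁅d i, d j⁆ = 0 := hzero _ (hlie _ (hdL i) _ (hdL j)) fun k => by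
      rw [Derivation.commutator_apply, hda, hda]
      split_ifs <;> simp
    have := congrArg (fun D' : Derivation F E E => D' x) h
    simpa [Derivation.commutator_apply, sub_eq_zero] using this
  have hnil : ∀ i x, (d i)^[p] x = 0 := fun i x => by
    obtain ⟨D', hD'⟩ := Derivation.exists_coe_eq_iterate p hp (d i)
    have h : D' = 0 := hzero _ (hpow _ (hdL i) D' hD') fun k => by
      obtain ⟨q, rfl⟩ : ∃ q, p = q + 2 := ⟨p - 2, by have := hp.two_le; omega⟩
      rw [hD', Function.iterate_succ_apply, Function.iterate_succ_apply, hda]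
      split_ifs <;> simp
    rw [← hD', h, Derivation.zero_apply]
  have hD0 : D = ∑ i, D (a i) • d i := by
    refine Derivation.ext fun x => Derivation.eqOn_adjoin (R := F)
      (s := {x | ∀ i, d i x = 0} ∪ Set.range a) ?_
      (Derivation.mem_adjoin_of_apply_eq_ite p hp d a hda hcomm hnil x)
    rintro x (hx | ⟨j, rfl⟩)
    · rw [hD x (hconst x hx), hsum]
      exact (Finset.sum_eq_zero fun i _ => by rw [hx i, mul_zero]).symm
    · exact sub_eq_zero.1 (hsum_a D j)
  rw [hD0]
  exact hsumL D

theorem IntermediateField.finrank_adjoin_simple_of_pow_mem {K E : Type*} [Field K] [Field E]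
    [Algebra K E] (p : ℕ) (hp : p.Prime) [CharP E p] {x : E}
    (hx : x ∉ (algebraMap K E).range) (hxp : x ^ p ∈ (algebraMap K E).range) :
    Module.finrank K (IntermediateField.adjoin K {x}) = p := by
  have : Fact p.Prime := ⟨hp⟩
  obtain ⟨y, hy⟩ := hxp
  have hirr : Irreducible (Polynomial.X ^ p - Polynomial.C y) :=
    X_pow_sub_C_irreducible_of_prime hp fun b hb => hx ⟨b, by
      apply frobenius_inj E p
      rw [frobenius_def, frobenius_def, ← map_pow, hb, hy]⟩
  have hmonic := Polynomial.monic_X_pow_sub_C y hp.ne_zero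
  have hmin := minpoly.eq_of_irreducible_of_monic (x := x) hirr (by simp [hy]) hmonic
  rw [IntermediateField.adjoin.finrank ⟨_, hmonic, by simp [hy]⟩, ← hmin,
    Polynomial.natDegree_X_pow_sub_C]

/-- A nontrivial finite purely inseparable extension has a nonzero derivation. -/
theorem IsPurelyInseparable.exists_derivation_ne_zero {K E : Type*} [Field K] [Field E]
    [Algebra K E] [FiniteDimensional K E] [IsPurelyInseparable K E]
    (h : ¬ Function.Surjective (algebraMap K E)) : ∃ D : Derivation K E E, D ≠ 0 := by
  by_contra! H
  refine h ?_
  have hsub : Subsingleton (Ω[E⁄K]) := by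
    refine subsingleton_of_forall_eq 0 fun w => ?_
    refine (Module.forall_dual_apply_eq_zero_iff E w).1 fun f => ?_
    rw [Derivation.liftKaehlerDifferential_unique f 0 ?_, LinearMap.zero_apply]
    rw [H (f.compDer _), H (LinearMap.compDer 0 _)]
  have : Algebra.FormallyUnramified K E := ⟨hsub⟩
  have : Algebra.IsSeparable K E := Algebra.FormallyUnramified.isSeparable K E
  exact IsPurelyInseparable.surjective_algebraMap_of_isSeparable K E

/-- If `E ^ p ⊆ F`, then the derivations of `E / F` vanishing on an intermediate field detect
the elements outside of it. -/
theorem IntermediateField.exists_derivation_apply_ne_zero {F E : Type*} [Field F] [Field E]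
    [Algebra F E] [FiniteDimensional F E] (p : ℕ) (hp : p.Prime) [CharP E p]
    (hpow : ∀ x : E, x ^ p ∈ (algebraMap F E).range) (K : IntermediateField F E) {a : E}
    (ha : a ∉ K) : ∃ D : Derivation F E E, (∀ x ∈ K, D x = 0) ∧ D a ≠ 0 := by
  have hwf : WellFoundedGT (IntermediateField F E) :=
    StrictMono.wellFoundedGT (f := fun M => Subalgebra.toSubmodule M.toSubalgebra) fun _ _ h => h
  obtain ⟨M, ⟨hKM, haM⟩, hmax⟩ := wellFounded_gt.has_min
    {M : IntermediateField F E | K ≤ M ∧ a ∉ M} ⟨K, le_rfl, ha⟩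
  have hpowM : ∀ x : E, x ^ p ∈ (algebraMap M E).range := fun x => by
    obtain ⟨y, hy⟩ := hpow x
    exact ⟨algebraMap F M y, by rw [← hy]; rfl⟩
  have hnot : ∀ {x : E}, x ∉ M → x ∉ (algebraMap M E).range := by
    rintro x hx ⟨y, rfl⟩
    exact hx y.2
  have : CharP M p := (algebraMap M E).charP (algebraMap M E).injective p
  have : ExpChar M p := .prime hp
  have : IsPurelyInseparable M E :=
    (isPurelyInseparable_iff_pow_mem M p).2 fun x => ⟨1, by simpa using hpowM x⟩
  obtain ⟨D, hD⟩ := IsPurelyInseparable.exists_derivation_ne_zero (K := M) (E := E)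
    fun h => hnot haM (h a)
  have hDM : ∀ x ∈ M, D x = 0 := fun x hx => D.map_algebraMap ⟨x, hx⟩
  refine ⟨D.restrictScalars F, fun x hx => hDM x (hKM hx), fun hDa => hD ?_⟩
  change D a = 0 at hDa
  ext b
  rw [Derivation.zero_apply]
  by_cases hb : b ∈ M
  · exact hDM b hb
  have hbM : b ∈ IntermediateField.adjoin M {b} :=
    IntermediateField.subset_adjoin _ _ rfl
  have hab : a ∈ IntermediateField.adjoin M {b} := by
    by_contra hab
    refine hmax ((IntermediateField.adjoin M {b}).restrictScalars F) ⟨?_, hab⟩ ?_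
    · exact fun x hx => (IntermediateField.adjoin M {b}).algebraMap_mem ⟨x, hKM hx⟩
    · refine lt_of_le_of_ne
        (fun x hx => (IntermediateField.adjoin M {b}).algebraMap_mem ⟨x, hx⟩) fun h => hb ?_
      rw [h]
      exact hbM
  have heq : IntermediateField.adjoin M {a} = IntermediateField.adjoin M {b} :=
    IntermediateField.eq_of_le_of_finrank_eq (IntermediateField.adjoin_simple_le_iff.2 hab) <| by
      rw [IntermediateField.finrank_adjoin_simple_of_pow_mem p hp (hnot haM) (hpowM a),
        IntermediateField.finrank_adjoin_simple_of_pow_mem p hp (hnot hb) (hpowM b)]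
  rw [← heq, ← IntermediateField.mem_toSubalgebra,
    IntermediateField.adjoin_simple_toSubalgebra_of_isAlgebraic (.of_finite M a)]
    at hbM
  refine Derivation.eqOn_adjoin (D1 := D) (D2 := 0) ?_ hbM
  rintro _ rfl
  exact hDa

set_option synthInstance.maxHeartbeats 400000
set_option maxHeartbeats 1000000

/-- **Jacobson's Galois correspondence for purely inseparable extensions.**
Let `E = F(c_1, …, c_n)` with `c_i^p ∈ F`, in characteristic `p > 0`.  Let `𝔏` be the set of
`E`-subspaces of `Der_F(E)` closed under the commutator bracket and under `p`-th powers
(`p`-fold composites).  Then `L ↦ E^L = {a ∈ E | D(a) = 0 ∀ D ∈ L}` is an order-reversing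
bijection from `𝔏` onto the set of intermediate fields of `E/F`. -/
theorem jacobson_derivation_galois_correspondence
    (F E : Type*) [Field F] [Field E] [Algebra F E]
    (p : ℕ) (hp : p.Prime) [CharP E p]
    (n : ℕ) (c : Fin n → E)
    (hgen : IntermediateField.adjoin F (Set.range c) = ⊤)
    (hcp : ∀ i : Fin n, ∃ a : F, c i ^ p = algebraMap F E a)
    (𝔏 : Set (Submodule E (Derivation F E E)))
    (h𝔏 : 𝔏 = {L : Submodule E (Derivation F E E) |
      (∀ D₁ ∈ L, ∀ D₂ ∈ L, ⁅D₁, D₂⁆ ∈ L) ∧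
      (∀ D ∈ L, ∀ D' : Derivation F E E, ⇑D' = (⇑D)^[p] → D' ∈ L)}) :
    (∀ L₁ ∈ 𝔏, ∀ L₂ ∈ 𝔏,
      {a : E | ∀ D ∈ L₁, D a = 0} = {a : E | ∀ D ∈ L₂, D a = 0} → L₁ = L₂) ∧
    (∀ K : IntermediateField F E, ∃ L ∈ 𝔏, {a : E | ∀ D ∈ L, D a = 0} = (K : Set E)) ∧
    (∀ L₁ ∈ 𝔏, ∀ L₂ ∈ 𝔏,
      L₁ ≤ L₂ ↔ {a : E | ∀ D ∈ L₂, D a = 0} ⊆ {a : E | ∀ D ∈ L₁, D a = 0}) := by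
  have : Fact p.Prime := ⟨hp⟩
  have : CharP F p := (algebraMap F E).charP (algebraMap F E).injective p
  have hintegral : ∀ i, IsIntegral F (c i) := fun i => by
    obtain ⟨a, ha⟩ := hcp i
    exact .of_pow hp.pos (ha ▸ isIntegral_algebraMap)
  have hfin : FiniteDimensional F E := by
    have := IntermediateField.finiteDimensional_adjoin (K := F) (S := Set.range c)
      (Set.forall_mem_range.2 hintegral)
    rw [hgen] at this
    exact IntermediateField.topEquiv.toLinearEquiv.finiteDimensional
  have hpow : ∀ x : E, x ^ p ∈ (algebraMap F E).range := fun x => by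
    have hx : x ∈ IntermediateField.adjoin F (Set.range c) := hgen ▸ IntermediateField.mem_top
    induction hx using IntermediateField.adjoin_induction with
    | mem x hx =>
      obtain ⟨i, rfl⟩ := hx
      obtain ⟨a, ha⟩ := hcp i
      exact ⟨a, ha.symm⟩
    | algebraMap x => exact ⟨x ^ p, map_pow _ _ _⟩
    | add x y _ _ hx hy => exact add_pow_char x y p ▸ add_mem hx hy
    | inv x _ hx =>
      obtain ⟨a, ha⟩ := hx
      exact ⟨a⁻¹, by rw [map_inv₀, ha, inv_pow]⟩
    | mul x y _ _ hx hy => exact mul_pow x y p ▸ mul_mem hx hy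
  have hder : FiniteDimensional E (Derivation F E E) := by
    let b := Module.finBasis F E
    let ev : Derivation F E E →ₗ[E] Fin (Module.finrank F E) → E :=
      { toFun := fun D i => D (b i)
        map_add' := fun _ _ => rfl
        map_smul' := fun _ _ => rfl }
    refine Module.Finite.of_injective ev fun D D' h => ?_
    have : (D : E →ₗ[F] E) = D' := b.ext fun i => congrFun h i
    exact Derivation.ext fun x => LinearMap.congr_fun this x
  have key : ∀ L₁ ∈ 𝔏, ∀ L₂ ∈ 𝔏,
      {a : E | ∀ D ∈ L₂, D a = 0} ⊆ {a : E | ∀ D ∈ L₁, D a = 0} → L₁ ≤ L₂ := by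
    intro L₁ _ L₂ h₂ hle D hD
    rw [h𝔏] at h₂
    exact Derivation.mem_of_forall_constant p hp L₂ h₂.1 h₂.2 D fun x hx => hle hx D hD
  refine ⟨fun L₁ h₁ L₂ h₂ h => le_antisymm (key L₁ h₁ L₂ h₂ h.ge) (key L₂ h₂ L₁ h₁ h.le),
    fun K => ?_, fun L₁ h₁ L₂ h₂ => ⟨fun hle a ha D hD => ha D (hle hD), key L₁ h₁ L₂ h₂⟩⟩
  refine ⟨{ carrier := {D | ∀ x ∈ K, D x = 0}
            add_mem' := fun {D D'} hD hD' x hx => by simp [hD x hx, hD' x hx]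
            zero_mem' := fun x _ => rfl
            smul_mem' := fun e D hD x hx => by simp [hD x hx] }, ?_, ?_⟩
  · rw [h𝔏]
    refine ⟨fun D₁ h₁ D₂ h₂ x hx => ?_, fun D hD D' hD' x hx => ?_⟩
    · rw [Derivation.commutator_apply, h₁ x hx, h₂ x hx, map_zero, map_zero, sub_zero]
    · rw [hD', ← Nat.sub_one_add_one hp.ne_zero, Function.iterate_succ_apply, hD x hx,
        iterate_map_zero]
  · refine Set.Subset.antisymm (fun a ha => ?_) fun a ha D hD => hD a ha
    by_contra haK
    obtain ⟨D, hDK, hDa⟩ := K.exists_derivation_apply_ne_zero p hp hpow haK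
    exact hDa (ha D hDK)
end

section
/- Let L be a finite-dimensional simple Lie algebra over a field F of characteristic p > 2. If L is strongly degenerate, i.e. L contains a nonzero sandwich element c (an element c ≠ 0 with (ad c)^2 = 0), then the Killing form of L is identically zero: trace((ad x) ∘ (ad y)) = 0 for all x, y ∈ L. -/
open LieAlgebra in
/-- In a Lie algebra over a field in which `2 ≠ 0`, a sandwich element `c` satisfies
`ad c ∘ ad x ∘ ad c = 0` for every `x`. -/
theorem ad_mul_ad_mul_ad_eq_zero_of_sq_eq_zero
    {F L : Type*} [Field F] (h2 : (2 : F) ≠ 0) [LieRing L] [LieAlgebra F L]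
    {c : L} (hc : ad F L c ^ 2 = 0) (x : L) : ad F L c * ad F L x * ad F L c = 0 := by
  have hcc (y : L) : ⁅c, ⁅c, y⁆⁆ = 0 := by
    simpa [pow_two] using LinearMap.congr_fun hc y
  ext y
  have h : (2 : F) • ⁅c, ⁅x, ⁅c, y⁆⁆⁆ = 0 := by
    have e : ⁅⁅c, ⁅c, x⁆⁆, y⁆ = 0 := by rw [hcc, zero_lie]
    rw [lie_lie, lie_lie, lie_lie, lie_sub, hcc, hcc, lie_zero, zero_sub, sub_zero] at e
    rw [two_smul, ← neg_eq_zero, neg_add, ← sub_eq_add_neg]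
    exact e
  simpa [h2] using h

open LieAlgebra in
/-- A sandwich element lies in the radical of the Killing form when `2 ≠ 0`. -/
theorem killingForm_apply_eq_zero_of_ad_sq_eq_zero
    {F L : Type*} [Field F] (h2 : (2 : F) ≠ 0) [LieRing L] [LieAlgebra F L]
    [Module.Finite F L] {c : L} (hc : ad F L c ^ 2 = 0) (x : L) :
    killingForm F L c x = 0 := by
  rw [killingForm_apply_apply]
  refine (LinearMap.isNilpotent_trace_of_isNilpotent ⟨2, ?_⟩).eq_zero
  change (ad F L c * ad F L x) ^ 2 = 0
  rw [pow_two, ← mul_assoc, ad_mul_ad_mul_ad_eq_zero_of_sq_eq_zero h2 hc, zero_mul]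

/-- A strongly degenerate finite-dimensional simple Lie algebra over a field
of characteristic `p > 2` has identically zero Killing form. -/
theorem killing_form_eq_zero_of_strongly_degenerate
    (F : Type*) [Field F] (p : ℕ) [CharP F p] (hp : 2 < p)
    (L : Type*) [LieRing L] [LieAlgebra F L] [Module.Finite F L]
    [LieAlgebra.IsSimple F L]
    (c : L) (hc0 : c ≠ 0) (hc : (LieAlgebra.ad F L c) ^ 2 = 0) :
    ∀ x y : L, LinearMap.trace F L ((LieAlgebra.ad F L x) ∘ₗ (LieAlgebra.ad F L y)) = 0 := by
  have h2 : (2 : F) ≠ 0 := Ring.two_ne_zero (by rw [ringChar.eq F p]; exact hp.ne')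
  have hmem : c ∈ LieIdeal.killingCompl F L ⊤ := by
    rw [LieIdeal.mem_killingCompl]
    intro y _
    rw [LieModule.traceForm_comm]
    exact killingForm_apply_eq_zero_of_ad_sq_eq_zero h2 hc y
  have htop : LieIdeal.killingCompl F L ⊤ = ⊤ :=
    (LieAlgebra.IsSimple.eq_bot_or_eq_top _).resolve_left fun h =>
      hc0 ((LieSubmodule.mem_bot c).mp (h ▸ hmem))
  intro x y
  have hy : y ∈ LieIdeal.killingCompl F L ⊤ := by
    rw [htop]
    exact LieSubmodule.mem_top y
  rw [← killingForm_apply_apply]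
  exact (LieIdeal.mem_killingCompl F L ⊤).mp hy x (LieSubmodule.mem_top x)
end

section
/- Let L be a Lie algebra over a field F of characteristic different from 2. Then the set 𝒮(L) of sandwich elements of L is closed under the Lie bracket: if a, b ∈ L satisfy (ad a)^2 = 0 and (ad b)^2 = 0, then (ad ⁅a,b⁆)^2 = 0. -/
/-- The adjoint action of a bracket is the commutator of the adjoint actions. -/
theorem ad_lie_eq_sub
    {F : Type*} [CommRing F] {L : Type*} [LieRing L] [LieAlgebra F L] (x y : L) :
    LieAlgebra.ad F L ⁅x, y⁆ =
      LieAlgebra.ad F L x * LieAlgebra.ad F L y - LieAlgebra.ad F L y * LieAlgebra.ad F L x := by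
  ext z
  simp

/-- If `a` is a sandwich element of a Lie algebra over a field of characteristic `≠ 2`, then
`ad a * ad x * ad a = 0` for all `x`. -/
theorem ad_mul_ad_mul_ad_eq_zero_of_sq
    {F : Type*} [Field F] (hchar : ringChar F ≠ 2)
    {L : Type*} [LieRing L] [LieAlgebra F L]
    {a : L} (ha : (LieAlgebra.ad F L a) ^ 2 = 0) (x : L) :
    LieAlgebra.ad F L a * LieAlgebra.ad F L x * LieAlgebra.ad F L a = 0 := by
  have hax : ⁅a, ⁅a, x⁆⁆ = 0 := by simpa [sq] using LinearMap.congr_fun ha x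
  have h : LieAlgebra.ad F L ⁅a, ⁅a, x⁆⁆ = 0 := by rw [hax, map_zero]
  rw [ad_lie_eq_sub, ad_lie_eq_sub] at h
  generalize LieAlgebra.ad F L a = A at *
  generalize LieAlgebra.ad F L x = X at *
  have h2 : (2 : F) • (A * X * A) = 0 := by
    calc (2 : F) • (A * X * A) = A ^ 2 * X + X * A ^ 2
          - (A * (A * X - X * A) - (A * X - X * A) * A) := by
          rw [two_smul]; noncomm_ring
      _ = 0 := by rw [h, ha]; simp
  exact (smul_eq_zero.mp h2).resolve_left (Ring.two_ne_zero hchar)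

/-- Over a field of characteristic `≠ 2`, the set of sandwich elements of a
Lie algebra is closed under the Lie bracket. -/
theorem sandwich_lie_closed
    (F : Type*) [Field F] (hchar : ringChar F ≠ 2)
    (L : Type*) [LieRing L] [LieAlgebra F L]
    (a b : L) (ha : (LieAlgebra.ad F L a) ^ 2 = 0) (hb : (LieAlgebra.ad F L b) ^ 2 = 0) :
    (LieAlgebra.ad F L ⁅a, b⁆) ^ 2 = 0 := by
  have hab := ad_mul_ad_mul_ad_eq_zero_of_sq hchar ha b
  have hba := ad_mul_ad_mul_ad_eq_zero_of_sq hchar hb a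
  rw [ad_lie_eq_sub]
  generalize LieAlgebra.ad F L a = A at *
  generalize LieAlgebra.ad F L b = B at *
  calc (A * B - B * A) ^ 2
      = A * B * A * B - A * B ^ 2 * A - B * A ^ 2 * B + B * A * B * A := by noncomm_ring
    _ = 0 := by rw [hab, hba, ha, hb]; simp
end

section
/- Let L be a finite-dimensional simple Lie algebra over a field F of characteristic different from 2, and suppose L is strongly degenerate, i.e. 𝒮(L) ≠ {0}. Let M = ⟨𝒮(L)⟩ be the Lie subalgebra of L spanned by the sandwich elements, and let N be the normalizer of M in L. Then N is a nonzero proper subalgebra of L (N ≠ 0 and N ≠ L), and N is invariant under every Lie algebra automorphism of L: φ(N) = N for every automorphism φ of L. -/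
namespace LieSubalgebra

open LieModule

variable {R L : Type*} [CommRing R] [LieRing L] [LieAlgebra R L]

/-- Adjoining to a subalgebra acting nilpotently on `L` an ad-nilpotent element of its normalizer
gives a subalgebra which still acts nilpotently on `L`. -/
theorem exists_isNilpotent_of_mem_normalizer {K : LieSubalgebra R L}
    (hK : LieModule.IsNilpotent K L) {x : L} (hx : x ∈ K.normalizer)
    (hxn : IsNilpotent (LieAlgebra.ad R L x)) :
    ∃ K' : LieSubalgebra R L, K'.toSubmodule = R ∙ x ⊔ K.toSubmodule ∧
      LieModule.IsNilpotent K' L := by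
  let K' : LieSubalgebra R L :=
    { (R ∙ x) ⊔ (K : Submodule R L) with
      lie_mem' := fun {y z} => lie_mem_sup_of_mem_normalizer hx }
  have hxK' : x ∈ K' := Submodule.mem_sup_left (Submodule.subset_span (Set.mem_singleton _))
  have hKK' : K ≤ K' := (toSubmodule_le_toSubmodule K K').mp le_sup_right
  have hK' : K' ≤ K.normalizer := by
    rw [← toSubmodule_le_toSubmodule]
    exact sup_le ((Submodule.span_singleton_le_iff_mem _ _).mpr hx) K.le_normalizer
  refine ⟨K', rfl, ?_⟩
  obtain ⟨I, hI₁ : (I : LieSubalgebra R K') = ofLe hKK'⟩ :=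
    exists_nested_lieIdeal_ofLe_normalizer hKK' hK'
  have hI₂ : R ∙ (⟨x, hxK'⟩ : K') ⊔ LieSubmodule.toSubmodule I = ⊤ := by
    rw [← LieIdeal.toLieSubalgebra_toSubmodule R K' I, hI₁]
    apply Submodule.map_injective_of_injective (K' : Submodule R L).injective_subtype
    simp only [coe_ofLe, Submodule.map_sup, Submodule.map_subtype_range_inclusion,
      Submodule.map_top, Submodule.range_subtype]
    rw [Submodule.map_subtype_span_singleton]
  let e : K ≃ₗ⁅R⁆ I :=
    (equivOfLe hKK').trans (LieEquiv.ofEq _ _ ((coe_set_eq _ _).mpr hI₁.symm))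
  have hI₃ : LieModule.IsNilpotent I L :=
    (Equiv.lieModule_isNilpotent_iff e (LinearEquiv.refl R L) fun _ _ => rfl).mp hK
  exact LieSubmodule.isNilpotentOfIsNilpotentSpanSupEqTop hI₂ hxn hI₃

/-- If a bracket-closed set is not contained in a subalgebra acting nilpotently on `L`, then it
contains an element outside the subalgebra which normalizes their intersection into the
subalgebra. -/
theorem exists_notMem_forall_lie_mem {s : Set L} (hs : ∀ x ∈ s, ∀ y ∈ s, ⁅x, y⁆ ∈ s)
    {K : LieSubalgebra R L} (hK : LieModule.IsNilpotent K L) (hsK : ¬ s ⊆ K) :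
    ∃ c ∈ s, c ∉ K ∧ ∀ k ∈ s, k ∈ K → ⁅k, c⁆ ∈ K := by
  by_contra! h
  have key (n : ℕ) : ∃ c ∈ s, c ∉ K ∧ c ∈ lowerCentralSeries R K L n := by
    induction n with
    | zero =>
      obtain ⟨c, hc, hcK⟩ := Set.not_subset.mp hsK
      exact ⟨c, hc, hcK, by simp⟩
    | succ n ih =>
      obtain ⟨c, hc, hcK, hcn⟩ := ih
      obtain ⟨k, hk, hkK, hkc⟩ := h c hc hcK
      refine ⟨⁅k, c⁆, hs k hk c hc, hkc, ?_⟩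
      rw [lowerCentralSeries_succ]
      exact LieSubmodule.lie_mem_lie (LieSubmodule.mem_top (⟨k, hkK⟩ : K)) hcn
  obtain ⟨n, hn⟩ := LieModule.IsNilpotent.nilpotent R K L
  obtain ⟨c, -, hcK, hcn⟩ := key n
  rw [hn, LieSubmodule.mem_bot] at hcn
  exact hcK (hcn ▸ K.zero_mem)

end LieSubalgebra

namespace LieAlgebra

variable {R L : Type*} [CommRing R] [LieRing L] [LieAlgebra R L]

/-- A special case of *Jacobson's theorem on weakly closed sets*: a Noetherian Lie algebra spanned
by a bracket-closed set of ad-nilpotent elements is nilpotent. -/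
theorem isNilpotent_of_span_eq_top [IsNoetherian R L] {s : Set L}
    (hs : ∀ x ∈ s, ∀ y ∈ s, ⁅x, y⁆ ∈ s) (hnil : ∀ x ∈ s, IsNilpotent (ad R L x))
    (hspan : Submodule.span R s = ⊤) : LieRing.IsNilpotent L := by
  let P : Set (LieSubalgebra R L) :=
    {K | LieModule.IsNilpotent K L ∧ K.toSubmodule ≤ Submodule.span R (s ∩ K)}
  have hP : P.Nonempty := by
    refine ⟨⊥, ?_, by simp⟩
    have : LieModule.IsTrivial (⊥ : LieSubalgebra R L) L :=
      ⟨fun x m => by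
        rw [LieSubalgebra.coe_bracket_of_module, (LieSubalgebra.mem_bot _).mp x.2, zero_lie]⟩
    infer_instance
  obtain ⟨K, ⟨hK, hKs⟩, hmax⟩ := (LieSubalgebra.wellFoundedGT_of_noetherian R L).wf.has_min P hP
  have hsK : s ⊆ K := by
    by_contra hsK
    obtain ⟨c, hc, hcK, hck⟩ := LieSubalgebra.exists_notMem_forall_lie_mem hs hK hsK
    have hcN : c ∈ K.normalizer := by
      rw [LieSubalgebra.mem_normalizer_iff']
      intro y hy
      replace hy := hKs hy
      induction hy using Submodule.span_induction with
      | mem k hk => exact hck k hk.1 hk.2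
      | zero => simp
      | add y z _ _ hy hz => rw [add_lie]; exact K.add_mem hy hz
      | smul t y _ hy => rw [smul_lie]; exact K.smul_mem t hy
    obtain ⟨K', hK', hnK'⟩ :=
      LieSubalgebra.exists_isNilpotent_of_mem_normalizer hK hcN (hnil c hc)
    have hKK' : K ≤ K' := by
      rw [← LieSubalgebra.toSubmodule_le_toSubmodule, hK']
      exact le_sup_right
    have hcK' : c ∈ K' := by
      rw [← LieSubalgebra.mem_toSubmodule, hK']
      exact Submodule.mem_sup_left (Submodule.mem_span_singleton_self c)
    refine hmax K' ⟨hnK', ?_⟩ (lt_of_le_of_ne hKK' fun h => hcK (h ▸ hcK'))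
    rw [hK']
    refine sup_le ?_ (hKs.trans (Submodule.span_mono (Set.inter_subset_inter_right s hKK')))
    exact (Submodule.span_singleton_le_iff_mem _ _).mpr (Submodule.subset_span ⟨hc, hcK'⟩)
  obtain rfl : K = ⊤ := by
    rw [← LieSubalgebra.toSubmodule_inj, LieSubalgebra.top_toSubmodule, eq_top_iff, ← hspan]
    exact Submodule.span_le.mpr hsK
  exact LieModule.isNilpotent_of_top_iff (R := R) |>.mp hK

theorem ad_sq_eq_zero_iff {c : L} : ad R L c ^ 2 = 0 ↔ ∀ x : L, ⁅c, ⁅c, x⁆⁆ = 0 := by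
  simp [LinearMap.ext_iff, sq]

section Sandwich

variable {L : Type*} [LieRing L] {c d : L}

theorem lie_lie_lie_lie_eq_zero_of_sandwich (h2 : ∀ x : L, x + x = 0 → x = 0)
    (hc : ∀ x : L, ⁅c, ⁅c, x⁆⁆ = 0) (x y : L) : ⁅c, ⁅x, ⁅c, y⁆⁆⁆ = 0 := by
  have h : ⁅⁅c, x⁆, ⁅c, y⁆⁆ = 0 := by
    apply h2
    have := hc ⁅x, y⁆
    rw [leibniz_lie c x y, lie_add, leibniz_lie c ⁅c, x⁆ y, leibniz_lie c x ⁅c, y⁆, hc, hc] at this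
    simpa using this
  rw [leibniz_lie, h, hc, lie_zero, add_zero]

/-- The bracket of two sandwich elements is a sandwich element. -/
theorem lie_sandwich (h2 : ∀ x : L, x + x = 0 → x = 0) (hc : ∀ x : L, ⁅c, ⁅c, x⁆⁆ = 0)
    (hd : ∀ x : L, ⁅d, ⁅d, x⁆⁆ = 0) (x : L) : ⁅⁅c, d⁆, ⁅⁅c, d⁆, x⁆⁆ = 0 := by
  simp only [lie_lie c d, lie_sub, hc, hd, lie_zero,
    lie_lie_lie_lie_eq_zero_of_sandwich h2 hc, lie_lie_lie_lie_eq_zero_of_sandwich h2 hd, sub_zero]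

end Sandwich

/-- An automorphism preserves the property of being a sandwich element. -/
theorem ad_sq_map_eq_zero (φ : L ≃ₗ⁅R⁆ L) {c : L} (hc : ad R L c ^ 2 = 0) :
    ad R L (φ c) ^ 2 = 0 := by
  rw [ad_sq_eq_zero_iff] at hc ⊢
  intro x
  rw [← φ.apply_symm_apply x, ← LieEquiv.map_lie, ← LieEquiv.map_lie, hc, map_zero]

end LieAlgebra

namespace LieSubalgebra

variable {R L : Type*} [CommRing R] [LieRing L] [LieAlgebra R L]

theorem map_normalizer_le {M : LieSubalgebra R L} (φ : L ≃ₗ⁅R⁆ L)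
    (h : ∀ x ∈ M, φ x ∈ M) (h' : ∀ x ∈ M, φ.symm x ∈ M) :
    M.normalizer.map φ.toLieHom ≤ M.normalizer := by
  rintro _ ⟨x, hx, rfl⟩
  rw [mem_normalizer_iff]
  intro y hy
  have := h _ ((mem_normalizer_iff M x).mp hx _ (h' y hy))
  rwa [LieEquiv.map_lie, LieEquiv.apply_symm_apply] at this

end LieSubalgebra


/-- Let `L` be a finite-dimensional simple strongly degenerate Lie algebra
over a field of characteristic `≠ 2`, let `M` be the Lie subalgebra of `L` spanned by the
sandwich elements and `N` its normalizer.  Then `N` is nonzero, proper, and invariant under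
every automorphism of `L`. -/
theorem normalizer_of_sandwich_span
    (F : Type*) [Field F] (hchar : ringChar F ≠ 2)
    (L : Type*) [LieRing L] [LieAlgebra F L] [Module.Finite F L]
    [LieAlgebra.IsSimple F L]
    (hdeg : ∃ c : L, c ≠ 0 ∧ (LieAlgebra.ad F L c) ^ 2 = 0)
    (M : LieSubalgebra F L)
    (hM : M.toSubmodule = Submodule.span F {c : L | (LieAlgebra.ad F L c) ^ 2 = 0}) :
    M.normalizer ≠ ⊥ ∧ M.normalizer ≠ ⊤ ∧
      ∀ φ : L ≃ₗ⁅F⁆ L, LieSubalgebra.map φ.toLieHom M.normalizer = M.normalizer := by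
  have h2 : ∀ x : L, x + x = 0 → x = 0 := by
    intro x hx
    rw [← two_smul F x] at hx
    exact (smul_eq_zero.mp hx).resolve_left (Ring.two_ne_zero hchar)
  have hmem {c : L} (hc : LieAlgebra.ad F L c ^ 2 = 0) : c ∈ M := by
    rw [← LieSubalgebra.mem_toSubmodule, hM]
    exact Submodule.subset_span hc
  obtain ⟨c, hc0, hc⟩ := hdeg
  refine ⟨fun h => ?_, fun h => ?_, fun φ => ?_⟩
  · have := M.le_normalizer (hmem hc)
    rw [h, LieSubalgebra.mem_bot] at this
    exact hc0 this
  · let I : LieIdeal F L :=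
      { M.toSubmodule with
        lie_mem := fun {x m} hm => (M.mem_normalizer_iff x).mp (by simp [h]) m hm }
    rcases LieAlgebra.IsSimple.eq_bot_or_eq_top (R := F) I with hI | hI
    · have : c ∈ I := hmem hc
      rw [hI, LieSubmodule.mem_bot] at this
      exact hc0 this
    · have hspan : Submodule.span F {c : L | LieAlgebra.ad F L c ^ 2 = 0} = ⊤ := by
        rw [← hM]
        exact congrArg LieSubmodule.toSubmodule hI
      have hnil : LieRing.IsNilpotent L :=
        LieAlgebra.isNilpotent_of_span_eq_top (R := F) (s := {c : L | LieAlgebra.ad F L c ^ 2 = 0})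
          (fun x hx y hy => LieAlgebra.ad_sq_eq_zero_iff.mpr <| LieAlgebra.lie_sandwich h2
            (LieAlgebra.ad_sq_eq_zero_iff.mp hx) (LieAlgebra.ad_sq_eq_zero_iff.mp hy))
          (fun x hx => ⟨2, hx⟩) hspan
      have : Nontrivial L := ⟨c, 0, hc0⟩
      have hcenter : Nontrivial (LieModule.maxTrivSubmodule F L L) :=
        LieModule.nontrivial_max_triv_of_isNilpotent F L L
      rcases LieAlgebra.IsSimple.eq_bot_or_eq_top (R := F)
        (LieModule.maxTrivSubmodule F L L) with hZ | hZ
      · exact (LieSubmodule.nontrivial_iff_ne_bot F L L).mp hcenter hZ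
      · exact LieAlgebra.IsSimple.non_abelian F
          (L := L) ((LieModule.isTrivial_iff_max_triv_eq_top F L L).mpr hZ)
  · have hmap (ψ : L ≃ₗ⁅F⁆ L) : ∀ x ∈ M, ψ x ∈ M := by
      intro x hx
      rw [← LieSubalgebra.mem_toSubmodule, hM] at hx
      induction hx using Submodule.span_induction with
      | mem x hx => exact hmem (LieAlgebra.ad_sq_map_eq_zero ψ hx)
      | zero => simp
      | add x y _ _ hx hy => rw [map_add]; exact M.add_mem hx hy
      | smul t x _ hx => rw [map_smul]; exact M.smul_mem t hx
    refine le_antisymm (LieSubalgebra.map_normalizer_le φ (hmap φ) (hmap φ.symm)) fun x hx => ?_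
    exact ⟨φ.symm x, LieSubalgebra.map_normalizer_le φ.symm (hmap φ.symm) (hmap φ) ⟨x, hx, rfl⟩,
      φ.apply_symm_apply x⟩
end

section
/- Let L be a finite-dimensional Lie algebra over a field F of characteristic 0. Then L has no nonzero sandwich elements (i.e. every c ∈ L with (ad c)^2 = 0 is zero) if and only if L is semisimple, i.e. the solvable radical of L is zero. -/
/-- If `c` is a sandwich element, then `(ad c) (ad z) (ad c) = 0` for every `z`. -/
lemma LieAlgebra.ad_mul_ad_mul_ad_eq_zero
    {F L : Type*} [Field F] [CharZero F] [LieRing L] [LieAlgebra F L]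
    {c : L} (hc : (LieAlgebra.ad F L c) ^ 2 = 0) (z : L) :
    LieAlgebra.ad F L c * LieAlgebra.ad F L z * LieAlgebra.ad F L c = 0 := by
  have h (y : L) : ⁅c, ⁅c, y⁆⁆ = 0 := by
    simpa [sq] using LinearMap.congr_fun hc y
  ext y
  have key : (2 : F) • ⁅c, ⁅z, ⁅c, y⁆⁆⁆ = 0 := by
    have hz : ⁅⁅c, ⁅c, z⁆⁆, y⁆ = -((2 : F) • ⁅c, ⁅z, ⁅c, y⁆⁆⁆) := by
      rw [lie_lie c, lie_lie c z, lie_lie c z, lie_sub, h, h, lie_zero, two_smul]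
      abel
    rwa [h, zero_lie, zero_eq_neg] at hz
  simpa using key

/-- In a Lie algebra with non-degenerate Killing form, every sandwich element is zero. -/
lemma LieAlgebra.eq_zero_of_ad_sq_eq_zero
    {F L : Type*} [Field F] [CharZero F] [LieRing L] [LieAlgebra F L] [Module.Finite F L]
    [LieAlgebra.IsKilling F L] {c : L} (hc : (LieAlgebra.ad F L c) ^ 2 = 0) : c = 0 := by
  have hker : c ∈ LinearMap.ker (killingForm F L) := by
    ext z
    have hnil : IsNilpotent (LieAlgebra.ad F L c * LieAlgebra.ad F L z) :=
      ⟨2, by rw [sq, ← mul_assoc, ad_mul_ad_mul_ad_eq_zero hc, zero_mul]⟩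
    simpa [killingForm_apply_apply, Module.End.mul_eq_comp] using
      (LinearMap.isNilpotent_trace_of_isNilpotent hnil).eq_zero
  simpa using hker

/-- Every element of an abelian ideal is a sandwich element. -/
lemma LieIdeal.ad_sq_eq_zero_of_isLieAbelian
    {F L : Type*} [CommRing F] [LieRing L] [LieAlgebra F L]
    (I : LieIdeal F L) [IsLieAbelian I] {c : L} (hc : c ∈ I) :
    (LieAlgebra.ad F L c) ^ 2 = 0 := by
  ext y
  have h : ⁅(⟨c, hc⟩ : I), (⟨⁅c, y⁆, lie_mem_left F L I c y hc⟩ : I)⁆ = 0 := trivial_lie_zero _ _ _ _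
  simpa [sq] using congrArg Subtype.val h

/-- A finite-dimensional Lie algebra over a field of characteristic `0` has
no nonzero sandwich elements if and only if its solvable radical is zero. -/
theorem no_sandwich_iff_radical_eq_bot
    (F : Type*) [Field F] [CharZero F]
    (L : Type*) [LieRing L] [LieAlgebra F L] [Module.Finite F L] :
    (∀ c : L, (LieAlgebra.ad F L c) ^ 2 = 0 → c = 0) ↔ LieAlgebra.radical F L = ⊥ := by
  constructor
  · intro h
    have : LieAlgebra.HasTrivialRadical F L := by
      rw [LieAlgebra.hasTrivialRadical_iff_no_abelian_ideals]
      intro I _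
      rw [eq_bot_iff]
      intro c hc
      simpa using h c (I.ad_sq_eq_zero_of_isLieAbelian hc)
    exact LieAlgebra.HasTrivialRadical.radical_eq_bot
  · intro h c hc
    have : LieAlgebra.HasTrivialRadical F L := ⟨h⟩
    exact LieAlgebra.eq_zero_of_ad_sq_eq_zero hc
end

section
/- Let F be a field of characteristic p > 0, let m ≥ 1 be a natural number with (p, m) ≠ (2, 1), and let A = F[X_1, …, X_m]/(X_1^p, …, X_m^p) be the truncated polynomial algebra in m variables. Then the Lie algebra W(m;1) := Der_F(A) of F-linear derivations of A (with bracket the commutator) is a simple Lie algebra, and its dimension over F is m·p^m. -/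
set_option synthInstance.maxHeartbeats 1000000
set_option maxHeartbeats 1000000

/-- The truncated polynomial algebra `F[X_1, …, X_m]/(X_1^p, …, X_m^p)`. -/
abbrev TruncatedMvPolynomial (F : Type*) [Field F] (p m : ℕ) :=
  MvPolynomial (Fin m) F ⧸
    Ideal.span (Set.range fun i : Fin m => (MvPolynomial.X i : MvPolynomial (Fin m) F) ^ p)

namespace TruncatedMvPolynomial

open MvPolynomial

variable {F : Type*} [Field F] {p m : ℕ}

variable (F p m) in
/-- The quotient map onto the truncated polynomial algebra. -/
noncomputable def proj : MvPolynomial (Fin m) F →ₐ[F] TruncatedMvPolynomial F p m :=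
  Ideal.Quotient.mkₐ F _

lemma proj_surjective : Function.Surjective (proj F p m) :=
  Ideal.Quotient.mkₐ_surjective F _

lemma proj_eq_zero_iff (f : MvPolynomial (Fin m) F) :
    proj F p m f = 0 ↔ ∀ b : Fin m →₀ ℕ, (∀ i, b i < p) → coeff b f = 0 := by
  have h : (Set.range fun i : Fin m => (X i : MvPolynomial (Fin m) F) ^ p) =
      (fun s => monomial s (1 : F)) '' Set.range fun i : Fin m => Finsupp.single i p := by
    rw [← Set.range_comp]
    congr 1
    ext1 i
    simp [X_pow_eq_monomial]
  rw [proj, Ideal.Quotient.mkₐ_eq_mk, Ideal.Quotient.eq_zero_iff_mem, h,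
    mem_ideal_span_monomial_image]
  refine forall_congr' fun b => ?_
  simp only [mem_support_iff, Set.exists_range_iff, Finsupp.single_le_iff]
  rw [← not_imp_not]
  simp

variable (F p m) in
/-- The coefficients of the monomials whose exponents are all less than `p`. -/
noncomputable def truncatedCoeffs : MvPolynomial (Fin m) F →ₗ[F] ((Fin m → Fin p) → F) :=
  LinearMap.pi fun a => lcoeff F (Finsupp.equivFunOnFinite.symm fun i => (a i : ℕ))

lemma ker_truncatedCoeffs :
    LinearMap.ker (truncatedCoeffs F p m) = LinearMap.ker (proj F p m).toLinearMap := by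
  ext f
  simp only [LinearMap.mem_ker, AlgHom.toLinearMap_apply, proj_eq_zero_iff]
  constructor
  · intro h b hb
    have := congr_fun h fun i => ⟨b i, hb i⟩
    simpa [truncatedCoeffs] using this
  · intro h
    ext a
    exact h _ fun i => (a i).2

lemma truncatedCoeffs_surjective : Function.Surjective (truncatedCoeffs F p m) := by
  classical
  intro c
  refine ⟨∑ a, monomial (Finsupp.equivFunOnFinite.symm fun i => (a i : ℕ)) (c a), ?_⟩
  ext a
  have h (a' : Fin m → Fin p) : (Finsupp.equivFunOnFinite.symm fun i => (a' i : ℕ)) =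
      (Finsupp.equivFunOnFinite.symm fun i => (a i : ℕ)) ↔ a' = a := by
    simp [funext_iff, Fin.ext_iff]
  simp [truncatedCoeffs, coeff_monomial, h]

variable (F p m) in
/-- A truncated polynomial is the same as its family of coefficients. -/
noncomputable def coeffsEquiv : TruncatedMvPolynomial F p m ≃ₗ[F] ((Fin m → Fin p) → F) :=
  ((proj F p m).toLinearMap.quotKerEquivOfSurjective proj_surjective).symm ≪≫ₗ
    Submodule.quotEquivOfEq _ _ ker_truncatedCoeffs.symm ≪≫ₗ
    (truncatedCoeffs F p m).quotKerEquivOfSurjective truncatedCoeffs_surjective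

instance : Module.Finite F (TruncatedMvPolynomial F p m) :=
  Module.Finite.equiv (coeffsEquiv F p m).symm

lemma finrank_eq : Module.finrank F (TruncatedMvPolynomial F p m) = p ^ m := by
  rw [(coeffsEquiv F p m).finrank_eq, Module.finrank_pi]
  simp

lemma natCast_ne_zero [CharP F p] {n : ℕ} (h0 : n ≠ 0) (hn : n < p) : (n : F) ≠ 0 := by
  rw [Ne, CharP.cast_eq_zero_iff F p]
  exact fun h => (Nat.le_of_dvd (Nat.pos_of_ne_zero h0) h).not_gt hn

lemma proj_pderiv_eq_zero [CharP F p] (i : Fin m) (f : MvPolynomial (Fin m) F)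
    (hf : proj F p m f = 0) : proj F p m (pderiv i f) = 0 := by
  classical
  rw [proj_eq_zero_iff] at hf ⊢
  intro b hb
  rw [coeff_pderiv]
  by_cases h : b i + 1 < p
  · rw [hf _ fun j => ?_, zero_mul]
    by_cases hj : i = j
    · subst hj; simpa using h
    · simpa [hj] using hb j
  · have h' : b i + 1 = p := by have := hb i; omega
    rw [← Nat.cast_add_one, h', CharP.cast_eq_zero, mul_zero]

lemma derivation_ext
    {D E : Derivation F (TruncatedMvPolynomial F p m) (TruncatedMvPolynomial F p m)}
    (h : ∀ i, D (proj F p m (X i)) = E (proj F p m (X i))) : D = E := by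
  refine Derivation.ext_of_adjoin_eq_top (Set.range fun i => proj F p m (X i)) ?_ ?_
  · have : (Set.range fun i => proj F p m (X i)) =
        proj F p m '' Set.range (X : Fin m → MvPolynomial (Fin m) F) := by
      rw [← Set.range_comp]; rfl
    rw [this, ← AlgHom.map_adjoin, adjoin_range_X, Algebra.map_top, AlgHom.range_eq_top]
    exact proj_surjective
  · rintro _ ⟨i, rfl⟩
    exact h i

lemma lie_smul_smul_apply
    (D E : Derivation F (TruncatedMvPolynomial F p m) (TruncatedMvPolynomial F p m))
    (f g : TruncatedMvPolynomial F p m) (x : TruncatedMvPolynomial F p m) :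
    ⁅f • D, g • E⁆ x = (f * D g) * E x - (g * E f) * D x + f * g * ⁅D, E⁆ x := by
  simp only [Derivation.commutator_apply, Derivation.smul_apply, smul_eq_mul, Derivation.leibniz]
  ring

variable [CharP F p]

variable (F p) in
/-- The partial derivative on the truncated polynomial algebra. -/
noncomputable def partialDeriv (i : Fin m) :
    Derivation F (TruncatedMvPolynomial F p m) (TruncatedMvPolynomial F p m) :=
  Derivation.liftOfSurjective (f := proj F p m) proj_surjective (d := pderiv i)
    (proj_pderiv_eq_zero i)

@[simp]
lemma partialDeriv_proj (i : Fin m) (f : MvPolynomial (Fin m) F) :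
    partialDeriv F p i (proj F p m f) = proj F p m (pderiv i f) :=
  Derivation.liftOfSurjective_apply _ (proj_pderiv_eq_zero i) f

lemma partialDeriv_X (i j : Fin m) :
    partialDeriv F p i (proj F p m (X j)) = if i = j then 1 else 0 := by
  split_ifs with h
  · simp [h]
  · simp [pderiv_X_of_ne (Ne.symm h)]

lemma sum_smul_partialDeriv_X (f : Fin m → TruncatedMvPolynomial F p m) (j : Fin m) :
    (∑ i, f i • partialDeriv F p i) (proj F p m (X j)) = f j := by
  have h := map_sum (Derivation.coeFnAddMonoidHom
    (R := F) (A := TruncatedMvPolynomial F p m) (M := TruncatedMvPolynomial F p m))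
    (fun i => f i • partialDeriv F p i) Finset.univ
  have h' := congr_fun h (proj F p m (X j))
  simp only [Derivation.coeFnAddMonoidHom_apply, Finset.sum_apply, Derivation.smul_apply,
    partialDeriv_X] at h'
  simpa using h'

lemma eq_sum_smul_partialDeriv
    (D : Derivation F (TruncatedMvPolynomial F p m) (TruncatedMvPolynomial F p m)) :
    D = ∑ i, D (proj F p m (X i)) • partialDeriv F p i :=
  derivation_ext fun j =>
    (sum_smul_partialDeriv_X (fun i => D (proj F p m (X i))) j).symm

variable (F p m) in
/-- A derivation is determined by its values on the variables, which are arbitrary. -/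
noncomputable def derivationEquiv :
    Derivation F (TruncatedMvPolynomial F p m) (TruncatedMvPolynomial F p m) ≃ₗ[F]
      (Fin m → TruncatedMvPolynomial F p m) where
  toFun D i := D (proj F p m (X i))
  map_add' _ _ := rfl
  map_smul' _ _ := rfl
  invFun f := ∑ i, f i • partialDeriv F p i
  left_inv D := (eq_sum_smul_partialDeriv D).symm
  right_inv f := funext (sum_smul_partialDeriv_X f)

lemma finrank_derivation :
    Module.finrank F (Derivation F (TruncatedMvPolynomial F p m) (TruncatedMvPolynomial F p m)) =
      m * p ^ m := by
  rw [(derivationEquiv F p m).finrank_eq, Module.finrank_pi_fintype]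
  simp [finrank_eq]

lemma lie_partialDeriv_apply_X (i j : Fin m)
    (D : Derivation F (TruncatedMvPolynomial F p m) (TruncatedMvPolynomial F p m)) :
    ⁅partialDeriv F p i, D⁆ (proj F p m (X j)) = partialDeriv F p i (D (proj F p m (X j))) := by
  rw [Derivation.commutator_apply, partialDeriv_X]
  split_ifs <;> simp

lemma lie_partialDeriv (i j : Fin m) : ⁅partialDeriv F p i, partialDeriv F p j⁆ = 0 := by
  refine derivation_ext fun k => ?_
  rw [lie_partialDeriv_apply_X, partialDeriv_X]
  split_ifs <;> simp

lemma lie_smul_partialDeriv (f g : TruncatedMvPolynomial F p m) (i j : Fin m) :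
    ⁅f • partialDeriv F p i, g • partialDeriv F p j⁆ =
      (f * partialDeriv F p i g) • partialDeriv F p j -
        (g * partialDeriv F p j f) • partialDeriv F p i := by
  ext x
  rw [lie_smul_smul_apply, lie_partialDeriv]
  simp

lemma lie_partialDeriv_smul (g : TruncatedMvPolynomial F p m) (i j : Fin m) :
    ⁅partialDeriv F p i, g • partialDeriv F p j⁆ =
      partialDeriv F p i g • partialDeriv F p j := by
  refine derivation_ext fun k => ?_
  rw [lie_partialDeriv_apply_X, Derivation.smul_apply, Derivation.smul_apply, partialDeriv_X]
  split_ifs <;> simp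

lemma exists_eq_algebraMap (f : TruncatedMvPolynomial F p m)
    (hf : ∀ i, partialDeriv F p i f = 0) : ∃ c : F, f = algebraMap F _ c := by
  classical
  obtain ⟨g, rfl⟩ := proj_surjective f
  refine ⟨coeff 0 g, ?_⟩
  rw [← AlgHom.commutes (proj F p m), ← sub_eq_zero, ← map_sub, proj_eq_zero_iff]
  intro b hb
  by_cases h0 : b = 0
  · simp [h0, algebraMap_eq]
  obtain ⟨i, hi⟩ : ∃ i, b i ≠ 0 := by simpa [Finsupp.ext_iff] using h0
  have h := hf i
  rw [partialDeriv_proj, proj_eq_zero_iff] at h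
  have h := h (b - Finsupp.single i 1) fun j => by
    have := hb j
    rw [Finsupp.tsub_apply]
    omega
  rw [coeff_pderiv, Finsupp.sub_add_single_one_cancel hi, mul_eq_zero] at h
  have hb' : (((b - Finsupp.single i 1 : Fin m →₀ ℕ) i : ℕ) : F) + 1 = (b i : F) := by
    rw [← Nat.cast_add_one, Finsupp.tsub_apply, Finsupp.single_eq_same,
      Nat.sub_add_cancel (Nat.pos_of_ne_zero hi)]
  rw [hb'] at h
  simpa [algebraMap_eq, coeff_C, Ne.symm h0] using
    h.resolve_right (natCast_ne_zero hi (hb i))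

section LieIdeal

variable (I : LieIdeal F
  (Derivation F (TruncatedMvPolynomial F p m) (TruncatedMvPolynomial F p m)))

lemma exists_lie_partialDeriv_eq_zero (N : ℕ)
    (D : Derivation F (TruncatedMvPolynomial F p m) (TruncatedMvPolynomial F p m))
    (hD : D ∈ I) (hD0 : D ≠ 0) (g : Fin m → MvPolynomial (Fin m) F)
    (hDg : ∀ j, D (proj F p m (X j)) = proj F p m (g j))
    (hg : ∀ j b, N ≤ Finsupp.degree b → coeff b (g j) = 0) :
    ∃ E : Derivation F (TruncatedMvPolynomial F p m) (TruncatedMvPolynomial F p m),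
      E ∈ I ∧ E ≠ 0 ∧ ∀ i : Fin m, ⁅partialDeriv F p i, E⁆ = 0 := by
  induction N generalizing D g with
  | zero =>
    refine absurd (derivation_ext fun j => ?_) hD0
    rw [hDg, show g j = 0 from MvPolynomial.ext _ _ fun b => by simpa using hg j b]
    simp
  | succ N ih =>
    by_cases h : ∀ i : Fin m, ⁅partialDeriv F p i, D⁆ = 0
    · exact ⟨D, hD, hD0, h⟩
    push Not at h
    obtain ⟨i, hi⟩ := h
    refine ih _ (I.lie_mem hD) hi (fun j => pderiv i (g j)) (fun j => ?_) fun j b hb => ?_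
    · rw [lie_partialDeriv_apply_X, hDg, partialDeriv_proj]
    · rw [coeff_pderiv, hg j, zero_mul]
      simpa using hb

variable {I}

lemma partialDeriv_mem (hI : I ≠ ⊥) (i : Fin m) : partialDeriv F p i ∈ I := by
  obtain ⟨D, hD, hD0⟩ : ∃ D, D ∈ I ∧ D ≠ 0 := by
    simpa [LieSubmodule.eq_bot_iff] using hI
  choose g hg using fun j => proj_surjective (D (proj F p m (X j)))
  obtain ⟨E, hE, hE0, h⟩ := exists_lie_partialDeriv_eq_zero I
    (Finset.univ.sup (fun j => (g j).totalDegree) + 1) D hD hD0 g (fun j => (hg j).symm)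
    fun j b hb => coeff_eq_zero_of_totalDegree_lt <| by
      have := Finset.le_sup (f := fun j => (g j).totalDegree) (Finset.mem_univ j)
      rw [← Finsupp.degree_apply]
      omega
  have hc (j : Fin m) : ∃ c : F, E (proj F p m (X j)) = algebraMap F _ c := by
    refine exists_eq_algebraMap _ fun i => ?_
    rw [← lie_partialDeriv_apply_X, h, Derivation.zero_apply]
  choose c hc using hc
  obtain ⟨k, hk⟩ : ∃ k, c k ≠ 0 := by
    by_contra! hk
    exact hE0 (derivation_ext fun j => by simp [hc, hk])
  have key : ⁅E, proj F p m (X k) • partialDeriv F p i⁆ = c k • partialDeriv F p i := by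
    refine derivation_ext fun j => ?_
    rw [Derivation.commutator_apply, hc, Derivation.map_algebraMap, Derivation.smul_apply,
      partialDeriv_X, Derivation.smul_apply, partialDeriv_X]
    split_ifs <;> simp [hc, Algebra.algebraMap_eq_smul_one]
  have hmem := lie_mem_left F _ I E (proj F p m (X k) • partialDeriv F p i) hE
  rw [key] at hmem
  simpa [smul_smul, hk] using I.smul_mem (c k)⁻¹ hmem

lemma monomial_smul_partialDeriv_mem_of_lt (hI : I ≠ ⊥) {b : Fin m →₀ ℕ} {i : Fin m}
    (hb : b i + 1 < p) (c : F) (j : Fin m) :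
    proj F p m (monomial b c) • partialDeriv F p j ∈ I := by
  have h0 : ((b i + 1 : ℕ) : F) ≠ 0 := natCast_ne_zero (Nat.succ_ne_zero _) hb
  have h : ⁅partialDeriv F p i, proj F p m (monomial (b + Finsupp.single i 1)
      (c / ((b i + 1 : ℕ) : F))) • partialDeriv F p j⁆ =
      proj F p m (monomial b c) • partialDeriv F p j := by
    rw [lie_partialDeriv_smul, partialDeriv_proj, pderiv_monomial, Finsupp.add_apply,
      Finsupp.single_eq_same, div_mul_cancel₀ _ h0, add_tsub_cancel_right]
  rw [← h]
  exact lie_mem_left F _ I _ _ (partialDeriv_mem hI i)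

lemma lie_X_smul_partialDeriv (b : Fin m →₀ ℕ) (c : F) (i j : Fin m) :
    ⁅proj F p m (X i) • partialDeriv F p i, proj F p m (monomial b c) • partialDeriv F p j⁆ =
      ((b i : F) - if i = j then 1 else 0) •
        proj F p m (monomial b c) • partialDeriv F p j := by
  rw [lie_smul_partialDeriv, partialDeriv_proj, ← map_mul, X_mul_pderiv_monomial,
    partialDeriv_X]
  ext x
  simp only [Derivation.sub_apply, Derivation.smul_apply, smul_eq_mul, sub_smul,
    Nat.cast_smul_eq_nsmul, eq_comm (a := j)]
  split_ifs with h
  · subst h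
    rw [map_nsmul, nsmul_eq_mul, nsmul_eq_mul, mul_one, mul_assoc,
      one_smul F (proj F p m (monomial b c) * partialDeriv F p i x)]
  · simp [mul_assoc]

lemma monomial_smul_partialDeriv_mem (hp : p.Prime) (hpm : ¬(p = 2 ∧ m = 1)) (hI : I ≠ ⊥)
    (b : Fin m →₀ ℕ) (c : F) (j : Fin m) :
    proj F p m (monomial b c) • partialDeriv F p j ∈ I := by
  classical
  by_cases hlt : ∃ i, b i + 1 < p
  · obtain ⟨i, hi⟩ := hlt
    exact monomial_smul_partialDeriv_mem_of_lt hI hi c j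
  by_cases hle : ∃ i, p ≤ b i
  · obtain ⟨i, hi⟩ := hle
    have : proj F p m (monomial b c) = 0 := by
      rw [proj_eq_zero_iff]
      intro b' hb'
      rw [coeff_monomial, if_neg]
      rintro rfl
      exact (hb' i).not_ge hi
    rw [this]
    convert I.zero_mem
    exact zero_smul (TruncatedMvPolynomial F p m) (partialDeriv F p j)
  push Not at hlt hle
  have hb (i : Fin m) : b i + 1 = p := le_antisymm (hle i) (hlt i)
  have hbF (i : Fin m) : (b i : F) = -1 := by
    rw [eq_neg_iff_add_eq_zero, ← Nat.cast_add_one, hb, CharP.cast_eq_zero]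
  obtain ⟨i, hXi, hi⟩ : ∃ i : Fin m, proj F p m (X i) • partialDeriv F p i ∈ I ∧
      (b i : F) - (if i = j then 1 else 0) ≠ 0 := by
    by_cases hij : ∃ i, i ≠ j
    · obtain ⟨i, hij⟩ := hij
      refine ⟨i, monomial_smul_partialDeriv_mem_of_lt hI (i := j) ?_ 1 i, ?_⟩
      · simpa [hij] using hp.one_lt
      · simp [hij, hbF]
    · push Not at hij
      have hp2 : 2 < p := lt_of_le_of_ne hp.two_le fun h => hpm ⟨h.symm, by
        have : Subsingleton (Fin m) := ⟨fun x y => (hij x).trans (hij y).symm⟩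
        have := Fin.subsingleton_iff_le_one.mp this
        have := j.2
        omega⟩
      refine ⟨j, monomial_smul_partialDeriv_mem_of_lt hI (i := j) ?_ 1 j, ?_⟩
      · simpa using hp2
      · rw [if_pos rfl, hbF, ← neg_add', neg_ne_zero, one_add_one_eq_two]
        exact_mod_cast natCast_ne_zero two_ne_zero hp2
  have h := lie_mem_left F _ I _ (proj F p m (monomial b c) • partialDeriv F p j) hXi
  rw [lie_X_smul_partialDeriv] at h
  have := I.smul_mem ((b i : F) - (if i = j then 1 else 0))⁻¹ h
  rwa [smul_smul, inv_mul_cancel₀ hi, one_smul] at this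

lemma eq_top_of_ne_bot (hp : p.Prime) (hpm : ¬(p = 2 ∧ m = 1)) (hI : I ≠ ⊥) : I = ⊤ := by
  rw [eq_top_iff]
  rintro D -
  rw [eq_sum_smul_partialDeriv D]
  refine sum_mem fun j _ => ?_
  obtain ⟨f, hf⟩ := proj_surjective (D (proj F p m (X j)))
  rw [← hf]
  clear hf
  induction f using MvPolynomial.induction_on' with
  | monomial b c => exact monomial_smul_partialDeriv_mem hp hpm hI b c j
  | add f g ihf ihg =>
    rw [map_add, add_smul]
    exact I.add_mem ihf ihg

end LieIdeal

lemma not_isLieAbelian_derivation (hp : p.Prime) (hm : 1 ≤ m) :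
    ¬ IsLieAbelian
      (Derivation F (TruncatedMvPolynomial F p m) (TruncatedMvPolynomial F p m)) := by
  intro h
  let i : Fin m := ⟨0, hm⟩
  have h1 := lie_partialDeriv_smul (p := p) (proj F p m (X i)) i i
  rw [h.trivial, partialDeriv_X, if_pos rfl, one_smul] at h1
  have h2 := partialDeriv_X (F := F) (p := p) i i
  rw [← h1, if_pos rfl, Derivation.zero_apply, ← map_one (proj F p m), eq_comm,
    proj_eq_zero_iff] at h2
  simpa using h2 0 fun _ => hp.pos

end TruncatedMvPolynomial

/-- For a field `F` of characteristic `p > 0` and `m ≥ 1` with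
`(p, m) ≠ (2, 1)`, the Jacobson–Witt algebra `W(m;1) = Der_F(F[X_i]/(X_i^p))` is a simple
Lie algebra of dimension `m·p^m`. -/
theorem jacobson_witt_algebra_isSimple_and_finrank
    (F : Type*) [Field F] (p : ℕ) [CharP F p] (hp : 0 < p)
    (m : ℕ) (hm : 1 ≤ m) (hpm : ¬(p = 2 ∧ m = 1)) :
    LieAlgebra.IsSimple F
      (Derivation F (TruncatedMvPolynomial F p m) (TruncatedMvPolynomial F p m)) ∧
    Module.finrank F
      (Derivation F (TruncatedMvPolynomial F p m) (TruncatedMvPolynomial F p m)) = m * p ^ m := by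
  have : NeZero p := ⟨hp.ne'⟩
  have hp' : p.Prime := CharP.char_prime_of_ne_zero F hp.ne'
  exact ⟨⟨fun I => or_iff_not_imp_left.mpr
    (TruncatedMvPolynomial.eq_top_of_ne_bot hp' hpm),
    TruncatedMvPolynomial.not_isLieAbelian_derivation hp' hm⟩,
    TruncatedMvPolynomial.finrank_derivation⟩
end

section
/- Let F be a field of characteristic p > 0, let A = F[X]/(X^p), and let x denote the image of X in A. Note that (1+x)^p = 1 in A, so for i ∈ ℤ/pℤ the element (1+x)^{i+1} ∈ A is well defined (using any integer representative of i+1). For i ∈ ℤ/pℤ define the derivation u_i ∈ Der_F(A) by u_i = (1+x)^{i+1}·∂, where ∂ is the derivation with ∂(x) = 1. Then the family (u_i)_{i ∈ ℤ/pℤ} is an F-basis of Der_F(A) and satisfies ⁅u_i, u_j⁆ = (j − i)·u_{i+j} for all i, j ∈ ℤ/pℤ (where j − i ∈ ℤ/pℤ acts on Der_F(A) as the corresponding scalar in the prime field of F). In particular, the Witt algebra W(1;1) = Der_F(F[X]/(X^p)) is isomorphic to the Zassenhaus algebra associated with the additive subgroup 𝔽_p of F. -/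
set_option synthInstance.maxHeartbeats 1000000
set_option maxHeartbeats 1000000

/-- The truncated polynomial algebra `A = F[X]/(X^p)`. -/
abbrev TruncatedPolynomial (F : Type*) [Field F] (p : ℕ) :=
  Polynomial F ⧸ Ideal.span {(Polynomial.X : Polynomial F) ^ p}

/-- The image `x` of `X` in `F[X]/(X^p)`. -/
noncomputable def truncX (F : Type*) [Field F] (p : ℕ) : TruncatedPolynomial F p :=
  Ideal.Quotient.mk _ Polynomial.X

theorem pow_zmod_val_eq {R : Type*} [Monoid R] {p : ℕ} [NeZero p] {y : R} (hy : y ^ p = 1)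
    {i : ZMod p} {n : ℕ} (h : (n : ZMod p) = i) : y ^ i.val = y ^ n := by
  subst h
  rw [ZMod.val_natCast, ← pow_mod_orderOf, Nat.mod_mod_of_dvd _ (orderOf_dvd_of_pow_eq_one hy),
    pow_mod_orderOf]

theorem Derivation.lie_smul_smul_self {R A : Type*} [CommRing R] [CommRing A] [Algebra R A]
    (D : Derivation R A A) (a b : A) : ⁅a • D, b • D⁆ = (a * D b - b * D a) • D := by
  ext c
  simp only [Derivation.commutator_apply, Derivation.smul_apply, smul_eq_mul, Derivation.leibniz]
  ring

theorem Derivation.mul_map_pow_of_map_eq_one {R A : Type*} [CommRing R] [CommRing A] [Algebra R A]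
    (D : Derivation R A A) {y : A} (hy : D y = 1) (n : ℕ) : y * D (y ^ n) = n * y ^ n := by
  rcases n with _ | n
  · simp
  · rw [Derivation.leibniz_pow, hy, Nat.add_sub_cancel, smul_eq_mul, mul_one, nsmul_eq_mul]
    ring

/-- The linear map `a ↦ a • D` from an algebra to its derivations. -/
def Derivation.smulLinear {R A : Type*} [CommRing R] [CommRing A] [Algebra R A]
    (D : Derivation R A A) : A →ₗ[R] Derivation R A A where
  toFun a := a • D
  map_add' a b := add_smul a b D
  map_smul' c a := smul_assoc c a D

theorem Derivation.smulLinear_apply {R A : Type*} [CommRing R] [CommRing A] [Algebra R A]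
    (D : Derivation R A A) (a : A) : D.smulLinear a = a • D := rfl

theorem LinearIndependent.smul_derivation {ι R A : Type*} [CommRing R] [CommRing A] [Algebra R A]
    {D : Derivation R A A} {x : A} (hx : D x = 1) {v : ι → A} (hv : LinearIndependent R v) :
    LinearIndependent R fun i => v i • D := by
  refine hv.map' D.smulLinear (LinearMap.ker_eq_bot'.2 fun a ha => ?_)
  simpa [Derivation.smulLinear_apply, hx] using DFunLike.congr_fun ha x

theorem Derivation.span_range_smul_eq_top {ι R A : Type*} [CommRing R] [CommRing A] [Algebra R A]
    {D : Derivation R A A} (hD : ∀ E : Derivation R A A, ∃ a : A, a • D = E) {v : ι → A}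
    (hv : Submodule.span R (Set.range v) = ⊤) :
    Submodule.span R (Set.range fun i => v i • D) = ⊤ := by
  have h : LinearMap.range D.smulLinear = ⊤ := LinearMap.range_eq_top.2 hD
  rw [← h, ← Submodule.map_top, ← hv, Submodule.map_span, ← Set.range_comp]
  rfl

theorem Derivation.lie_pow_smul_pow_smul {R A : Type*} [CommRing R] [CommRing A] [Algebra R A]
    (D : Derivation R A A) {y : A} (hy : IsUnit y) (hDy : D y = 1) {a b c : ℕ}
    (hc : y * y ^ c = y ^ (a + b)) :
    ⁅y ^ a • D, y ^ b • D⁆ = ((b : R) - a) • (y ^ c • D) := by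
  rw [Derivation.lie_smul_smul_self, ← smul_assoc]
  congr 1
  refine hy.mul_left_cancel ?_
  rw [mul_smul_comm, hc, Algebra.smul_def, _root_.map_sub, _root_.map_natCast, _root_.map_natCast,
    pow_add]
  linear_combination y ^ a * D.mul_map_pow_of_map_eq_one hDy b -
    y ^ b * D.mul_map_pow_of_map_eq_one hDy a

theorem aeval_truncX (F : Type*) [Field F] (p : ℕ) (q : Polynomial F) :
    Polynomial.aeval (truncX F p) q = Ideal.Quotient.mk _ q := by
  have h : Polynomial.aeval (truncX F p) =
      Ideal.Quotient.mkₐ F (Ideal.span {(Polynomial.X : Polynomial F) ^ p}) :=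
    Polynomial.algHom_ext (by simp [truncX])
  rw [h]
  rfl

theorem truncX_pow (F : Type*) [Field F] (p : ℕ) : truncX F p ^ p = 0 := by
  rw [truncX, ← map_pow, Ideal.Quotient.eq_zero_iff_mem]
  exact Ideal.mem_span_singleton_self _

theorem one_add_truncX_pow (F : Type*) [Field F] (p : ℕ) (hp : p.Prime) [CharP F p] :
    (1 + truncX F p) ^ p = 1 := by
  have : Fact p.Prime := ⟨hp⟩
  have h : ((1 + Polynomial.X : Polynomial F)) ^ p = 1 + Polynomial.X ^ p := by
    rw [add_pow_char, one_pow]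
  have h' := congrArg (Polynomial.aeval (truncX F p)) h
  simpa [truncX_pow] using h'

theorem adjoin_truncX (F : Type*) [Field F] (p : ℕ) : Algebra.adjoin F {truncX F p} = ⊤ := by
  rw [Algebra.adjoin_singleton_eq_range_aeval, AlgHom.range_eq_top]
  intro a
  obtain ⟨q, rfl⟩ := Ideal.Quotient.mk_surjective a
  exact ⟨q, aeval_truncX F p q⟩

theorem Derivation.eq_smul_of_map_truncX_eq_one {F : Type*} [Field F] {p : ℕ}
    {D : Derivation F (TruncatedPolynomial F p) (TruncatedPolynomial F p)}
    (hD : D (truncX F p) = 1)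
    (E : Derivation F (TruncatedPolynomial F p) (TruncatedPolynomial F p)) :
    E (truncX F p) • D = E := by
  refine Derivation.ext_of_adjoin_eq_top _ (adjoin_truncX F p) ?_
  rintro _ rfl
  simp [hD]

theorem span_one_add_truncX_pow (F : Type*) [Field F] (p : ℕ) (hp : p.Prime) [CharP F p] :
    Submodule.span F (Set.range fun i : ZMod p => (1 + truncX F p) ^ (i + 1 : ZMod p).val) =
      ⊤ := by
  have : NeZero p := ⟨hp.ne_zero⟩
  rw [eq_top_iff]
  rintro a -
  obtain ⟨q, rfl⟩ := Ideal.Quotient.mk_surjective a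
  have hq : Ideal.Quotient.mk _ q =
      Polynomial.aeval (1 + truncX F p) (q.comp (Polynomial.X - 1)) := by
    rw [Polynomial.aeval_comp]
    simp [aeval_truncX]
  rw [hq, Polynomial.aeval_eq_sum_range]
  refine Submodule.sum_mem _ fun n _ => Submodule.smul_mem _ _ (Submodule.subset_span ?_)
  exact ⟨(n : ZMod p) - 1, pow_zmod_val_eq (one_add_truncX_pow F p hp) (by ring)⟩

theorem linearIndependent_one_add_truncX_pow (F : Type*) [Field F] (p : ℕ) (hp : p.Prime)
    [CharP F p] :
    LinearIndependent F fun i : ZMod p => (1 + truncX F p) ^ (i + 1 : ZMod p).val := by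
  have : NeZero p := ⟨hp.ne_zero⟩
  refine linearIndependent_of_top_le_span_of_card_eq_finrank
    (span_one_add_truncX_pow F p hp).ge ?_
  rw [ZMod.card, finrank_quotient_span_eq_natDegree, Polynomial.natDegree_X_pow]

/-- In `A = F[X]/(X^p)` one has `(1+x)^p = 1`, and the derivations
`u_i = (1+x)^{i+1}·∂` (for `i ∈ ℤ/pℤ`, where `∂` is the derivation with `∂(x) = 1`) form an `F`-basis of
`Der_F(A)` satisfying `⁅u_i, u_j⁆ = (j−i)·u_{i+j}`; thus the Witt algebra `W(1;1)` is
isomorphic to the Zassenhaus algebra attached to `𝔽_p ⊆ F`. -/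
theorem witt_is_zassenhaus
    (F : Type*) [Field F] (p : ℕ) (hp : p.Prime) [CharP F p]
    (der : Derivation F (TruncatedPolynomial F p) (TruncatedPolynomial F p))
    (hder : der (truncX F p) = 1) :
    (1 + truncX F p) ^ p = 1 ∧
    LinearIndependent F (fun i : ZMod p =>
      ((1 + truncX F p) ^ (i + 1 : ZMod p).val • der :
        Derivation F (TruncatedPolynomial F p) (TruncatedPolynomial F p))) ∧
    Submodule.span F (Set.range fun i : ZMod p =>
      ((1 + truncX F p) ^ (i + 1 : ZMod p).val • der :
        Derivation F (TruncatedPolynomial F p) (TruncatedPolynomial F p))) = ⊤ ∧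
    ∀ i j : ZMod p,
      ⁅(1 + truncX F p) ^ (i + 1 : ZMod p).val • der,
        (1 + truncX F p) ^ (j + 1 : ZMod p).val • der⁆ =
      ZMod.castHom (dvd_refl p) F (j - i) •
        ((1 + truncX F p) ^ ((i + j) + 1 : ZMod p).val • der) := by
  have : NeZero p := ⟨hp.ne_zero⟩
  have hy := one_add_truncX_pow F p hp
  have hDy : der (1 + truncX F p) = 1 := by simp [hder]
  refine ⟨hy, (linearIndependent_one_add_truncX_pow F p hp).smul_derivation hder,
    Derivation.span_range_smul_eq_top
      (fun E => ⟨E (truncX F p), Derivation.eq_smul_of_map_truncX_eq_one hder E⟩)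
      (span_one_add_truncX_pow F p hp), fun i j => ?_⟩
  have hunit : IsUnit (1 + truncX F p) := IsUnit.of_pow_eq_one hy hp.ne_zero
  set y := 1 + truncX F p
  set a := (i + 1).val
  set b := (j + 1).val
  have ha' : (a : ZMod p) = i + 1 := ZMod.natCast_zmod_val _
  have hb' : (b : ZMod p) = j + 1 := ZMod.natCast_zmod_val _
  have hc : y * y ^ (i + j + 1).val = y ^ (a + b) := by
    rw [← pow_succ', ← pow_zmod_val_eq hy rfl, pow_zmod_val_eq hy]
    push_cast [ha', hb', ZMod.natCast_zmod_val]
    ring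
  have hij : ZMod.castHom (dvd_refl p) F (j - i) = (b : F) - a := by
    rw [show j - i = (b : ZMod p) - a by rw [ha', hb']; ring, map_sub, map_natCast, map_natCast]
  rw [hij]
  exact der.lie_pow_smul_pow_smul hunit hDy hc
end

section
/- Let F be a field of characteristic p > 2, let A = F[X]/(X^p) with x the image of X, and let W = Der_F(A) be the Witt algebra, with basis e_{−1}, e_0, …, e_{p−2} where e_i = x^{i+1}·∂ and ∂ is the derivation with ∂(x) = 1. Then the set 𝒮(W) of sandwich elements of W is exactly the F-linear span of the basis vectors e_i with 2i > p; equivalently, a derivation D ∈ W satisfies (ad D)^2 = 0 if and only if D = f·∂ for some f in the linear span of the monomials x^j with 2j > p + 2. -/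
set_option synthInstance.maxHeartbeats 1000000
set_option maxHeartbeats 1000000

open Polynomial in
theorem truncX_aeval_eq_mk (F : Type*) [Field F] (p : ℕ) (P : F[X]) :
    aeval (truncX F p) P = Ideal.Quotient.mk (Ideal.span {(X : F[X]) ^ p}) P := by
  have h := aeval_algHom_apply (Ideal.Quotient.mkₐ F (Ideal.span {(X : F[X]) ^ p})) X P
  rw [aeval_X_left_apply] at h
  exact h

open Polynomial in
theorem truncX_exists_aeval (F : Type*) [Field F] (p : ℕ) (f : TruncatedPolynomial F p) :
    ∃ P : F[X], aeval (truncX F p) P = f := by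
  obtain ⟨P, rfl⟩ := Ideal.Quotient.mk_surjective f
  exact ⟨P, truncX_aeval_eq_mk F p P⟩

open Polynomial in
theorem truncX_aeval_eq_zero_iff (F : Type*) [Field F] (p : ℕ) (P : F[X]) :
    aeval (truncX F p) P = 0 ↔ X ^ p ∣ P := by
  rw [truncX_aeval_eq_mk, Ideal.Quotient.eq_zero_iff_mem, Ideal.mem_span_singleton]

theorem truncX_pow_eq_zero (F : Type*) [Field F] (p n : ℕ) (h : p ≤ n) :
    truncX F p ^ n = 0 := by
  have := (truncX_aeval_eq_zero_iff F p (Polynomial.X ^ n)).2 (pow_dvd_pow _ h)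
  simpa using this

/-- Derivations of the truncated polynomial algebra agree when they agree at `x`. -/
theorem truncX_derivation_ext {F : Type*} [Field F] {p : ℕ}
    {D E : Derivation F (TruncatedPolynomial F p) (TruncatedPolynomial F p)}
    (h : D (truncX F p) = E (truncX F p)) : D = E := by
  ext f
  obtain ⟨P, rfl⟩ := truncX_exists_aeval F p f
  rw [Derivation.map_aeval, Derivation.map_aeval, h]

theorem derivation_eq_apply_truncX_smul {F : Type*} [Field F] {p : ℕ}
    {der : Derivation F (TruncatedPolynomial F p) (TruncatedPolynomial F p)}
    (hder : der (truncX F p) = 1)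
    (D : Derivation F (TruncatedPolynomial F p) (TruncatedPolynomial F p)) :
    D = D (truncX F p) • der :=
  truncX_derivation_ext (by simp [hder])

theorem mem_span_truncX_pow_iff (F : Type*) [Field F] (p m : ℕ) (f : TruncatedPolynomial F p) :
    f ∈ Submodule.span F {g : TruncatedPolynomial F p | ∃ j : ℕ, m ≤ j ∧ g = truncX F p ^ j} ↔
      truncX F p ^ m ∣ f := by
  constructor
  · intro hf
    induction hf using Submodule.span_induction with
    | mem g hg =>
      obtain ⟨j, hj, rfl⟩ := hg
      exact pow_dvd_pow _ hj
    | zero => exact dvd_zero _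
    | add a b _ _ ha hb => exact dvd_add ha hb
    | smul c a _ ha => exact dvd_smul_of_dvd c ha
  · rintro ⟨g, rfl⟩
    obtain ⟨P, rfl⟩ := truncX_exists_aeval F p g
    rw [Polynomial.aeval_eq_sum_range, Finset.mul_sum]
    refine Submodule.sum_mem _ fun i _ => ?_
    rw [mul_smul_comm, ← pow_add]
    exact Submodule.smul_mem _ _ (Submodule.subset_span ⟨m + i, Nat.le_add_right m i, rfl⟩)

theorem Derivation.ad_smul_sq_apply {R A : Type*} [CommRing R] [CommRing A] [Algebra R A]
    (d : Derivation R A A) (f g : A) :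
    ((LieAlgebra.ad R (Derivation R A A) (f • d)) ^ 2) (g • d) =
      (f ^ 2 * d (d g) - f * d f * d g + ((d f) ^ 2 - f * d (d f)) * g) • d := by
  ext a
  simp only [pow_two, Module.End.mul_apply, LieAlgebra.ad_apply, Derivation.commutator_apply,
    Derivation.smul_apply, smul_eq_mul, Derivation.leibniz, map_sub, map_add]
  ring

/-- A multiple of `∂` is a sandwich element iff its coefficient and the derivative of its
coefficient both square to zero. -/
theorem ad_smul_sq_eq_zero_iff {F : Type*} [Field F] {p : ℕ} (h2 : (2 : F) ≠ 0)
    {der : Derivation F (TruncatedPolynomial F p) (TruncatedPolynomial F p)}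
    (hder : der (truncX F p) = 1) (f : TruncatedPolynomial F p) :
    (LieAlgebra.ad F (Derivation F (TruncatedPolynomial F p) (TruncatedPolynomial F p))
        (f • der)) ^ 2 = 0 ↔ f ^ 2 = 0 ∧ der f ^ 2 = 0 := by
  have half {a : TruncatedPolynomial F p} (h : 2 * a = 0) : a = 0 := by
    have inv : algebraMap F (TruncatedPolynomial F p) 2⁻¹ * 2 = 1 := by
      rw [← map_ofNat (algebraMap F (TruncatedPolynomial F p)) 2, ← map_mul,
        inv_mul_cancel₀ h2, map_one]
    linear_combination algebraMap F (TruncatedPolynomial F p) 2⁻¹ * h - a * inv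
  have deriv_sq (hf : f ^ 2 = 0) : f * der f = 0 ∧ der f ^ 2 + f * der (der f) = 0 := by
    have h1 : f * der f = 0 := by
      apply half
      have := congrArg der hf
      rw [pow_two, Derivation.leibniz, map_zero] at this
      simp only [smul_eq_mul] at this
      linear_combination this
    refine ⟨h1, ?_⟩
    have := congrArg der h1
    rw [Derivation.leibniz, map_zero] at this
    simp only [smul_eq_mul] at this
    linear_combination this
  constructor
  · intro h
    have key (g : TruncatedPolynomial F p) :
        f ^ 2 * der (der g) - f * der f * der g + ((der f) ^ 2 - f * der (der f)) * g = 0 := by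
      have := congrArg (fun E => E (truncX F p)) (Derivation.ad_smul_sq_apply der f g)
      simpa [h, hder] using this.symm
    have k0 := key 1
    have k1 := key (truncX F p)
    have k2 := key (truncX F p ^ 2)
    simp only [Derivation.map_one_eq_zero, map_zero, hder, pow_two (truncX F p),
      Derivation.leibniz, smul_eq_mul, map_add, mul_one] at k0 k1 k2
    have hf : f ^ 2 = 0 := by
      apply half
      linear_combination k2 - 2 * truncX F p * k1 + truncX F p ^ 2 * k0
    refine ⟨hf, half ?_⟩
    linear_combination k0 + (deriv_sq hf).2
  · rintro ⟨hf, hf'⟩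
    obtain ⟨h1, h2⟩ := deriv_sq hf
    refine LinearMap.ext fun E => ?_
    rw [derivation_eq_apply_truncX_smul hder E, Derivation.ad_smul_sq_apply, LinearMap.zero_apply]
    set g := E (truncX F p)
    have : f ^ 2 * der (der g) - f * der f * der g + ((der f) ^ 2 - f * der (der f)) * g = 0 := by
      linear_combination der (der g) * hf - der g * h1 + 2 * g * hf' - g * h2
    rw [this]
    ext a
    rw [Derivation.smul_apply, smul_eq_mul, zero_mul, Derivation.zero_apply]

open Polynomial in
theorem sq_eq_zero_and_derivation_sq_eq_zero_iff {F : Type*} [Field F] {p k : ℕ}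
    (hk : 2 * k = p + 1) (hk0 : (k : F) ≠ 0)
    {der : Derivation F (TruncatedPolynomial F p) (TruncatedPolynomial F p)}
    (hder : der (truncX F p) = 1) (f : TruncatedPolynomial F p) :
    f ^ 2 = 0 ∧ der f ^ 2 = 0 ↔ truncX F p ^ (k + 1) ∣ f := by
  constructor
  · obtain ⟨P, rfl⟩ := truncX_exists_aeval F p f
    rw [Derivation.map_aeval, hder, smul_eq_mul, mul_one, ← map_pow, ← map_pow,
      truncX_aeval_eq_zero_iff, truncX_aeval_eq_zero_iff]
    have dvd_of_sq {Q : F[X]} (h : X ^ p ∣ Q ^ 2) : X ^ k ∣ Q := by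
      by_cases hQ : Q = 0
      · simp [hQ]
      rw [pow_dvd_iff_le_emultiplicity,
        FiniteMultiplicity.emultiplicity_eq_multiplicity
          (finiteMultiplicity_of_degree_pos_of_monic (by simp) monic_X hQ)]
      rw [pow_dvd_iff_le_emultiplicity,
        FiniteMultiplicity.emultiplicity_eq_multiplicity
          (finiteMultiplicity_of_degree_pos_of_monic (by simp) monic_X (pow_ne_zero 2 hQ)),
        FiniteMultiplicity.multiplicity_pow prime_X
          (finiteMultiplicity_of_degree_pos_of_monic (by simp) monic_X hQ)] at h
      norm_cast at h ⊢
      omega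
    rintro ⟨h, h'⟩
    obtain ⟨Q, rfl⟩ := dvd_of_sq h
    have hd := dvd_of_sq h'
    obtain ⟨n, rfl⟩ : ∃ n, k = n + 1 := ⟨k - 1, by omega⟩
    rw [derivative_mul, dvd_add_left (dvd_mul_right _ _), derivative_X_pow, Nat.add_sub_cancel,
      mul_right_comm, mul_comm, pow_succ, mul_dvd_mul_iff_left (pow_ne_zero n X_ne_zero),
      X_dvd_iff, coeff_C_mul, mul_eq_zero, or_iff_right hk0, ← X_dvd_iff] at hd
    obtain ⟨R, rfl⟩ := hd
    exact ⟨aeval (truncX F p) R, by simp only [map_mul, map_pow, aeval_X]; ring⟩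
  · rintro ⟨g, rfl⟩
    have h0 : truncX F p ^ (2 * k) = 0 := truncX_pow_eq_zero F p _ (by omega)
    constructor
    · linear_combination truncX F p ^ 2 * g ^ 2 * h0
    · rw [Derivation.leibniz, Derivation.leibniz_pow, hder, Nat.add_sub_cancel]
      simp only [smul_eq_mul, nsmul_eq_mul, mul_one]
      linear_combination (truncX F p * der g + g * (k + 1 : ℕ)) ^ 2 * h0

/-- The sandwich elements of the Witt algebra `W = Der_F(F[X]/(X^p))`
(`p > 2`) are exactly the `F`-span of the `e_i = x^{i+1}·∂` with `2i > p`; equivalently,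
`D` is a sandwich element iff `D = f·∂` with `f` in the span of the monomials `x^j`
with `2j > p + 2`. -/
theorem sandwich_elements_of_witt_algebra
    (F : Type*) [Field F] (p : ℕ) (hp : p.Prime) [CharP F p] (hp2 : 2 < p)
    (der : Derivation F (TruncatedPolynomial F p) (TruncatedPolynomial F p))
    (hder : der (truncX F p) = 1) :
    {D : Derivation F (TruncatedPolynomial F p) (TruncatedPolynomial F p) |
        (LieAlgebra.ad F (Derivation F (TruncatedPolynomial F p) (TruncatedPolynomial F p)) D) ^ 2
          = 0} =
      (Submodule.span F
        ((fun j : ℕ => (truncX F p ^ j) • der) '' {j : ℕ | p + 2 < 2 * j}) : Set _) ∧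
    ∀ D : Derivation F (TruncatedPolynomial F p) (TruncatedPolynomial F p),
      (LieAlgebra.ad F (Derivation F (TruncatedPolynomial F p) (TruncatedPolynomial F p)) D) ^ 2
          = 0 ↔
      ∃ f ∈ Submodule.span F {g : TruncatedPolynomial F p | ∃ j : ℕ, p + 2 < 2 * j ∧
          g = truncX F p ^ j},
        D = f • der := by
  have h2 : (2 : F) ≠ 0 := by
    intro h
    have := (CharP.cast_eq_zero_iff F p 2).1 (by exact_mod_cast h)
    exact absurd (Nat.le_of_dvd two_pos this) (by omega)
  obtain ⟨n, hn⟩ := hp.odd_of_ne_two (by omega)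
  have hk0 : ((n + 1 : ℕ) : F) ≠ 0 := by
    intro h
    exact absurd (Nat.le_of_dvd (by omega) ((CharP.cast_eq_zero_iff F p _).1 h)) (by omega)
  have hj (j : ℕ) : p + 2 < 2 * j ↔ n + 1 + 1 ≤ j := by omega
  have main : ∀ D : Derivation F (TruncatedPolynomial F p) (TruncatedPolynomial F p),
      (LieAlgebra.ad F (Derivation F (TruncatedPolynomial F p) (TruncatedPolynomial F p)) D) ^ 2
          = 0 ↔
      ∃ f ∈ Submodule.span F {g : TruncatedPolynomial F p | ∃ j : ℕ, p + 2 < 2 * j ∧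
          g = truncX F p ^ j},
        D = f • der := by
    intro D
    have sandwich_iff (f : TruncatedPolynomial F p) :=
      (ad_smul_sq_eq_zero_iff h2 hder f).trans
        (sq_eq_zero_and_derivation_sq_eq_zero_iff (k := n + 1) (by omega) hk0 hder f)
    simp only [hj, mem_span_truncX_pow_iff]
    constructor
    · intro h
      have hD := derivation_eq_apply_truncX_smul hder D
      rw [hD] at h
      exact ⟨_, (sandwich_iff _).1 h, hD⟩
    · rintro ⟨f, hf, rfl⟩
      exact (sandwich_iff f).2 hf
  refine ⟨?_, main⟩
  ext D
  rw [Set.mem_ofPred_eq, main, SetLike.mem_coe]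
  have himage : (fun j : ℕ => (truncX F p ^ j) • der) '' {j : ℕ | p + 2 < 2 * j} =
      ((LinearMap.toSpanSingleton (TruncatedPolynomial F p) _ der).restrictScalars F) ''
        {g : TruncatedPolynomial F p | ∃ j : ℕ, p + 2 < 2 * j ∧ g = truncX F p ^ j} := by
    ext E
    simp [eq_comm]
  rw [himage, Submodule.span_image, Submodule.mem_map]
  simp [eq_comm]
end

section
/- Let F be an algebraically closed field of characteristic p > 3 and let n be a positive multiple of p. Then the Lie algebra 𝔭𝔰𝔩(n, F) := 𝔰𝔩(n, F)/𝔷(𝔰𝔩(n, F)), the quotient of the special linear Lie algebra 𝔰𝔩(n, F) of traceless n×n matrices by its center (which consists of the scalar matrices, these being traceless since p divides n), is a simple Lie algebra. -/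
namespace LieAlgebra.SpecialLinear

variable {F ι : Type*} [Field F] [Fintype ι] [DecidableEq ι]

theorem lie_single_lie_single {i j : ι} (h : i ≠ j) (A : sl ι F) :
    ⁅single i j h (1 : F), ⁅single i j h (1 : F), A⁆⁆ = (-2 * A.val j i) • single i j h (1 : F) := by
  ext a b
  simp only [sl_bracket, val_single, mul_sub, sub_mul, ← mul_assoc, SetLike.val_smul,
    Matrix.single_mul_single_of_ne _ _ _ _ h.symm]
  simp only [mul_assoc, Matrix.single_mul_single_of_ne _ _ _ _ h.symm]
  simp only [← mul_assoc, Matrix.single_mul_mul_single]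
  simp [Matrix.single_apply]
  split_ifs <;> ring

theorem lie_single_of_isDiag {i j : ι} (h : i ≠ j) (A : sl ι F)
    (hA : A.val.IsDiag) :
    ⁅single i j h (1 : F), A⁆ = (A.val j j - A.val i i) • single i j h (1 : F) := by
  ext a b
  rw [sl_bracket, ← hA.diagonal_diag]
  simp only [val_single, SetLike.val_smul, Matrix.sub_apply, Matrix.mul_diagonal,
    Matrix.diagonal_mul, Matrix.smul_apply, Matrix.single_apply, Matrix.diagonal_apply_eq]
  split_ifs with hab
  · obtain ⟨rfl, rfl⟩ := hab
    simp
  · simp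

theorem lie_single_single_of_ne {i j k : ι} (hij : i ≠ j) (hjk : j ≠ k) (hik : i ≠ k) :
    ⁅single i j hij (1 : F), single j k hjk (1 : F)⁆ = single i k hik (1 : F) := by
  ext : 1
  rw [sl_bracket]
  simp [Matrix.single_mul_single_of_ne _ _ _ _ hik.symm]

theorem lie_single_single_symm {i j : ι} (hij : i ≠ j) :
    ⁅single i j hij (1 : F), single j i hij.symm (1 : F)⁆ = singleSubSingle i j (1 : F) := by
  ext : 1
  rw [sl_bracket]
  simp

theorem mem_center_of_isDiag {A : sl ι F} (hA : A.val.IsDiag)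
    (hdiag : ∀ k l, A.val k k = A.val l l) : A ∈ center F (sl ι F) := by
  rw [LieModule.mem_maxTrivSubmodule]
  intro B
  ext a b
  rw [sl_bracket, ← hA.diagonal_diag]
  simp [hdiag a b, mul_comm]

section Ideal

variable (I : LieIdeal F (sl ι F))

theorem single_mem_of_apply_ne_zero [NeZero (2 : F)] {A : sl ι F} (hA : A ∈ I) {i j : ι}
    (h : i ≠ j) (hne : A.val j i ≠ 0) : single i j h (1 : F) ∈ I := by
  have hmem := I.lie_mem (x := single i j h (1 : F)) (I.lie_mem (x := single i j h (1 : F)) hA)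
  rw [lie_single_lie_single] at hmem
  exact (I.toSubmodule.smul_mem_iff (mul_ne_zero (neg_ne_zero.2 two_ne_zero) hne)).1 hmem

theorem exists_single_mem_of_notMem_center [NeZero (2 : F)] {A : sl ι F} (hA : A ∈ I)
    (hcenter : A ∉ center F (sl ι F)) : ∃ i j, ∃ h : i ≠ j, single i j h (1 : F) ∈ I := by
  by_cases hoff : A.val.IsDiag
  · obtain ⟨k, l, hkl⟩ : ∃ k l, A.val k k ≠ A.val l l := by
      by_contra! hdiag
      exact hcenter (mem_center_of_isDiag hoff hdiag)
    have hne : l ≠ k := fun h ↦ hkl (h ▸ rfl)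
    refine ⟨l, k, hne, ?_⟩
    have hmem := I.lie_mem (x := single l k hne (1 : F)) hA
    rw [lie_single_of_isDiag _ _ hoff] at hmem
    exact (I.toSubmodule.smul_mem_iff (sub_ne_zero.2 hkl)).1 hmem
  · obtain ⟨k, l, hkl, hne⟩ : ∃ k l, k ≠ l ∧ A.val k l ≠ 0 := by
      by_contra! h
      exact hoff h
    exact ⟨l, k, hkl.symm, single_mem_of_apply_ne_zero I hA _ hne⟩

theorem single_mem_of_single_mem [NeZero (2 : F)] {i j : ι} {hij : i ≠ j}
    (hmem : single i j hij (1 : F) ∈ I) {k l : ι} (hkl : k ≠ l) : single k l hkl (1 : F) ∈ I := by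
  have left {a b c : ι} {hab : a ≠ b} (hcb : c ≠ b) (h : single a b hab (1 : F) ∈ I) :
      single c b hcb (1 : F) ∈ I := by
    rcases eq_or_ne c a with rfl | hca
    · exact h
    · rw [← lie_single_single_of_ne hca hab hcb]
      exact I.lie_mem h
  have right {a b c : ι} {hab : a ≠ b} (hac : a ≠ c) (h : single a b hab (1 : F) ∈ I) :
      single a c hac (1 : F) ∈ I := by
    rcases eq_or_ne b c with rfl | hbc
    · exact h
    · rw [← lie_single_single_of_ne hab hbc hac]
      exact lie_mem_left F _ I _ _ h
  rcases eq_or_ne k j with rfl | hkj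
  · rcases eq_or_ne l i with rfl | hli
    · exact single_mem_of_apply_ne_zero I hmem _ (by simp)
    · exact left hkl (right hli.symm hmem)
  · exact right hkl (left hkj hmem)

theorem eq_top_of_forall_single_mem
    (hI : ∀ i j, ∀ h : i ≠ j, single i j h (1 : F) ∈ I) : I = ⊤ := by
  rw [eq_top_iff]
  rintro A -
  rcases isEmpty_or_nonempty ι with _ | ⟨⟨o⟩⟩
  · convert I.zero_mem
    exact Subtype.ext (Subsingleton.elim _ _)
  have hdiag (i : ι) : singleSubSingle i o (1 : F) ∈ I := by
    rcases eq_or_ne i o with rfl | hio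
    · convert I.zero_mem
      ext : 1
      simp
    · rw [← lie_single_single_symm hio]
      exact I.lie_mem (hI _ _ _)
  let B (i j : ι) : sl ι F :=
    if h : i = j then singleSubSingle i o 1 else single i j h 1
  have hB (i j : ι) : B i j ∈ I := by
    unfold B
    split_ifs with h
    exacts [hdiag i, hI i j h]
  have hBval (i j : ι) : (B i j).val =
      Matrix.single i j 1 - if i = j then Matrix.single o o 1 else 0 := by
    unfold B
    split_ifs with h
    · subst h; simp
    · simp
  have hsum : A = ∑ i, ∑ j, A.val i j • B i j := by
    have htr : ∑ i, A.val i i = 0 := A.2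
    ext : 1
    simp only [AddSubmonoidClass.coe_finsetSum, SetLike.val_smul, hBval, smul_sub,
      Finset.sum_sub_distrib, smul_ite, smul_zero, Finset.sum_ite_eq, Finset.mem_univ, if_true,
      ← Finset.sum_smul, htr, zero_smul, sub_zero]
    simpa using Matrix.matrix_eq_sum_single A.val
  rw [hsum]
  exact I.toSubmodule.sum_mem fun i _ ↦ I.toSubmodule.sum_mem fun j _ ↦
    I.toSubmodule.smul_mem _ (hB i j)

theorem le_center_or_eq_top [NeZero (2 : F)] : I ≤ center F (sl ι F) ∨ I = ⊤ := by
  refine or_iff_not_imp_left.2 fun hI ↦ ?_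
  obtain ⟨A, hA, hcenter⟩ := SetLike.not_le_iff_exists.1 hI
  obtain ⟨i, j, h, hmem⟩ := exists_single_mem_of_notMem_center I hA hcenter
  exact eq_top_of_forall_single_mem I fun _ _ hkl ↦ single_mem_of_single_mem I hmem hkl

end Ideal

theorem singleSubSingle_notMem_center [NeZero (2 : F)] {i j : ι} (h : i ≠ j) :
    singleSubSingle i j (1 : F) ∉ center F (sl ι F) := by
  intro hmem
  have hmem := (LieModule.mem_maxTrivSubmodule F (sl ι F) (sl ι F) _).1 hmem (single j i h.symm 1)
  have key := congrFun₂ (congrArg Subtype.val hmem) j i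
  rw [sl_bracket] at key
  exact two_ne_zero (by simpa [mul_sub, sub_mul, h, one_add_one_eq_two] using key : (2 : F) = 0)

theorem isSimple_quotient_center [NeZero (2 : F)] [Nontrivial ι] :
    IsSimple F (sl ι F ⧸ center F (sl ι F)) where
  eq_bot_or_eq_top J := by
    let π : sl ι F →ₗ⁅F⁆ sl ι F ⧸ center F (sl ι F) :=
      { LieSubmodule.Quotient.mk' (center F (sl ι F)) with
        map_lie' := fun {x y} ↦ LieSubmodule.Quotient.mk_bracket (I := center F (sl ι F)) x y }
    have hπ : Function.Surjective π :=
      LieSubmodule.Quotient.surjective_mk' (center F (sl ι F))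
    rcases le_center_or_eq_top (J.comap π) with h | h
    · left
      rw [eq_bot_iff]
      intro x hx
      obtain ⟨A, rfl⟩ := hπ x
      exact (LieSubmodule.mem_bot _).2 <| (LieSubmodule.Quotient.mk_eq_zero (center F (sl ι F))).2
        (h (LieIdeal.mem_comap.2 hx))
    · right
      rw [eq_top_iff]
      rintro x -
      obtain ⟨A, rfl⟩ := hπ x
      exact LieIdeal.mem_comap.1 (h ▸ LieSubmodule.mem_top A)
  non_abelian hab := by
    obtain ⟨i, j, h⟩ := exists_pair_ne ι
    apply singleSubSingle_notMem_center (F := F) h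
    rw [← lie_single_single_symm h, ← LieSubmodule.Quotient.mk_eq_zero']
    exact (LieSubmodule.Quotient.mk_bracket (I := center F (sl ι F)) _ _).trans (hab.trivial _ _)

end LieAlgebra.SpecialLinear

/-- For an algebraically closed field `F` of characteristic `p > 3` and a
positive multiple `n` of `p`, the Lie algebra `𝔭𝔰𝔩(n, F) = 𝔰𝔩(n, F)/𝔷(𝔰𝔩(n, F))` is simple. -/
theorem psl_isSimple
    (F : Type*) [Field F] [IsAlgClosed F] (p : ℕ) [CharP F p] (hp : 3 < p)
    (n : ℕ) (hn : 0 < n) (hpn : p ∣ n) :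
    LieAlgebra.IsSimple F
      (↥(LieAlgebra.SpecialLinear.sl (Fin n) F) ⧸
        LieAlgebra.center F ↥(LieAlgebra.SpecialLinear.sl (Fin n) F)) := by
  have : NeZero (2 : F) := ⟨fun h ↦ by
    have := Nat.le_of_dvd two_pos ((CharP.cast_eq_zero_iff F p 2).1 (mod_cast h))
    omega⟩
  have : Nontrivial (Fin n) := Fin.nontrivial_iff_two_le.2 (by
    have := Nat.le_of_dvd hn hpn
    omega)
  exact LieAlgebra.SpecialLinear.isSimple_quotient_center
end

section
/- Let F be a field of characteristic p > 3, let A = F[X]/(X^p), and let W = Der_F(A) be the Witt algebra. Let D = ∂ ∈ W be the derivation with ∂(x) = 1, where x is the image of X. Then (ad D)^p = 0 as a linear endomorphism of W, so the exponential exp(ad D) := Σ_{k=0}^{p−1} (1/k!)·(ad D)^k is a well-defined invertible linear endomorphism of W; however, exp(ad D) is NOT a Lie algebra automorphism of W: there exist u, v ∈ W with exp(ad D)(⁅u, v⁆) ≠ ⁅exp(ad D)(u), exp(ad D)(v)⁆. -/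
set_option synthInstance.maxHeartbeats 1000000
set_option maxHeartbeats 1000000

namespace TruncatedPolynomial

variable {F : Type*} [Field F] {p : ℕ}

theorem mk_eq_aeval_truncX (q : Polynomial F) :
    (Ideal.Quotient.mk _ q : TruncatedPolynomial F p) = Polynomial.aeval (truncX F p) q := by
  have h : Ideal.Quotient.mkₐ F (Ideal.span {(Polynomial.X : Polynomial F) ^ p}) =
      Polynomial.aeval (truncX F p) := by
    ext
    simp [truncX]
  exact DFunLike.congr_fun h q

theorem truncX_pow_self : truncX F p ^ p = 0 := by
  rw [truncX, ← map_pow, Ideal.Quotient.eq_zero_iff_mem]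
  exact Ideal.mem_span_singleton_self _

theorem nontrivial_of_ne_zero (hp : p ≠ 0) : Nontrivial (TruncatedPolynomial F p) := by
  apply Ideal.Quotient.nontrivial_iff.mpr
  rw [Ne, Ideal.span_singleton_eq_top, isUnit_pow_iff hp]
  exact Polynomial.not_isUnit_X

theorem linearMap_ext {M : Type*} [AddCommGroup M] [Module F M]
    {f g : TruncatedPolynomial F p →ₗ[F] M}
    (h : ∀ n, f (truncX F p ^ n) = g (truncX F p ^ n)) : f = g := by
  refine LinearMap.ext fun a => ?_
  obtain ⟨q, rfl⟩ := Ideal.Quotient.mk_surjective a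
  rw [mk_eq_aeval_truncX, Polynomial.aeval_eq_sum_range, map_sum, map_sum]
  exact Finset.sum_congr rfl fun n _ => by rw [map_smul, map_smul, h]

theorem derivation_ext {d e : Derivation F (TruncatedPolynomial F p) (TruncatedPolynomial F p)}
    (h : d (truncX F p) = e (truncX F p)) : d = e := by
  have h' : (d : TruncatedPolynomial F p →ₗ[F] TruncatedPolynomial F p) = e :=
    linearMap_ext fun n => by
      simp only [Derivation.coeFn_coe, Derivation.leibniz_pow, h]
  exact Derivation.ext fun a => DFunLike.congr_fun h' a

section

variable {D : Derivation F (TruncatedPolynomial F p) (TruncatedPolynomial F p)}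

theorem iterate_derivation_truncX_pow (hD : D (truncX F p) = 1) (n k : ℕ) :
    D^[k] (truncX F p ^ n) = (n.descFactorial k : F) • truncX F p ^ (n - k) := by
  induction k with
  | zero => simp
  | succ k ih =>
    rw [Function.iterate_succ_apply', ih, Derivation.map_smul, Derivation.leibniz_pow, hD,
      Nat.descFactorial_succ, smul_eq_mul, mul_one, ← Nat.cast_smul_eq_nsmul F, smul_smul,
      Nat.sub_sub, mul_comm (n - k), Nat.cast_mul]

theorem iterate_derivation_eq_zero [CharP F p] (hp : 0 < p) (hD : D (truncX F p) = 1)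
    (a : TruncatedPolynomial F p) : D^[p] a = 0 := by
  have h : (D : Module.End F (TruncatedPolynomial F p)) ^ p = 0 :=
    linearMap_ext fun n => by
      have h0 : (n.descFactorial p : F) = 0 := by
        rw [CharP.cast_eq_zero_iff F p, Nat.descFactorial_eq_factorial_mul_choose]
        exact Dvd.dvd.mul_right (Nat.dvd_factorial hp le_rfl) _
      rw [Module.End.pow_apply]
      exact (iterate_derivation_truncX_pow hD n p).trans (by rw [h0, zero_smul]; rfl)
  simpa [Module.End.pow_apply] using DFunLike.congr_fun h a

theorem ad_pow_apply_truncX (hD : D (truncX F p) = 1) (k : ℕ)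
    (d : Derivation F (TruncatedPolynomial F p) (TruncatedPolynomial F p)) :
    ((LieAlgebra.ad F _ D) ^ k) d (truncX F p) = D^[k] (d (truncX F p)) := by
  induction k with
  | zero => simp
  | succ k ih =>
    rw [pow_succ', Module.End.mul_apply, LieAlgebra.ad_apply, Derivation.commutator_apply, hD,
      Derivation.map_one_eq_zero, sub_zero, ih, Function.iterate_succ_apply']

theorem ad_pow_eq_zero [CharP F p] (hp : 0 < p) (hD : D (truncX F p) = 1) :
    (LieAlgebra.ad F (Derivation F (TruncatedPolynomial F p) (TruncatedPolynomial F p)) D) ^ p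
      = 0 :=
  LinearMap.ext fun d => derivation_ext <| by
    rw [ad_pow_apply_truncX hD, iterate_derivation_eq_zero hp hD]
    rfl

/-- The truncated exponential `exp D` acts on `x ^ n`, `n < p`, as the substitution
`x ↦ x + 1`. -/
theorem sum_iterate_derivation_truncX_pow [CharP F p] (hp : p.Prime) (hD : D (truncX F p) = 1)
    {n : ℕ} (hn : n < p) :
    ∑ k ∈ Finset.range p, ((k.factorial : F)⁻¹) • D^[k] (truncX F p ^ n) =
      (1 + truncX F p) ^ n := by
  rw [add_pow]
  symm
  refine Finset.sum_subset_zero_on_sdiff (Finset.range_subset_range.mpr hn) ?_ ?_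
  · intro k hk
    simp only [Finset.mem_sdiff, Finset.mem_range, not_lt] at hk
    rw [iterate_derivation_truncX_pow hD, Nat.descFactorial_of_lt hk.2, Nat.cast_zero, zero_smul,
      smul_zero]
  · intro k hk
    have hk' : k < p := (Finset.mem_range.mp hk).trans_le hn
    have hfac : (k.factorial : F) ≠ 0 := by
      rw [Ne, CharP.cast_eq_zero_iff F p, hp.dvd_factorial]
      exact hk'.not_ge
    rw [iterate_derivation_truncX_pow hD, Nat.descFactorial_eq_factorial_mul_choose, Nat.cast_mul,
      smul_smul, inv_mul_cancel_left₀ hfac, one_pow, one_mul, Nat.cast_smul_eq_nsmul,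
      nsmul_eq_mul, mul_comm]

theorem sum_ad_pow_truncX_pow_smul [CharP F p] (hp : p.Prime) (hD : D (truncX F p) = 1)
    {n : ℕ} (hn : n < p) :
    (∑ k ∈ Finset.range p, ((k.factorial : F)⁻¹) • (LieAlgebra.ad F
      (Derivation F (TruncatedPolynomial F p) (TruncatedPolynomial F p)) D) ^ k)
        (truncX F p ^ n • D) = (1 + truncX F p) ^ n • D := by
  apply derivation_ext
  rw [LinearMap.sum_apply, Derivation.smul_apply, hD, smul_eq_mul, mul_one,
    ← sum_iterate_derivation_truncX_pow hp hD hn, ← Derivation.coeFnAddMonoidHom_apply, map_sum,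
    Finset.sum_apply]
  refine Finset.sum_congr rfl fun k _ => ?_
  rw [Derivation.coeFnAddMonoidHom_apply, LinearMap.smul_apply, Derivation.smul_apply,
    ad_pow_apply_truncX hD, Derivation.smul_apply, hD, smul_eq_mul, mul_one]

/-- If `D y = 1` then `⁅y ^ 2 • D, y ^ (p - 1) • D⁆ = -3 y ^ p • D`. -/
theorem lie_sq_smul_pow_pred_smul [CharP F p] (hp : 2 ≤ p) {y : TruncatedPolynomial F p}
    (hy : D y = 1) :
    ⁅y ^ 2 • D, y ^ (p - 1) • D⁆ = (-3 * y ^ p) • D := by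
  obtain ⟨m, rfl⟩ := Nat.exists_eq_add_of_le' hp
  have hm : (m : TruncatedPolynomial F (m + 2)) + 2 = 0 := by
    have h := congrArg (algebraMap F (TruncatedPolynomial F (m + 2))) (CharP.cast_eq_zero F (m + 2))
    rw [map_natCast, map_zero] at h
    exact_mod_cast h
  ext a
  simp only [Derivation.commutator_apply, Derivation.smul_apply, smul_eq_mul, Derivation.leibniz,
    Derivation.leibniz_pow, hy, nsmul_eq_mul, show m + 2 - 1 = m + 1 from rfl,
    Nat.add_sub_cancel]
  push_cast
  linear_combination (y ^ (m + 2) * D a) * hm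

end

end TruncatedPolynomial

open TruncatedPolynomial

/-- Let `W = Der_F(F[X]/(X^p))` be the Witt algebra over a field of
characteristic `p > 3` and let `∂ ∈ W` be the derivation with `∂(x) = 1`.  Then
`(ad ∂)^p = 0`, so `exp(ad ∂) = Σ_{k<p} (1/k!)·(ad ∂)^k` is a well-defined invertible linear
endomorphism of `W`; nevertheless it is not a Lie algebra automorphism of `W`. -/
theorem exp_ad_not_automorphism_of_witt
    (F : Type*) [Field F] (p : ℕ) (hp : p.Prime) [CharP F p] (hp3 : 3 < p)
    (der : Derivation F (TruncatedPolynomial F p) (TruncatedPolynomial F p))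
    (hder : der (truncX F p) = 1) :
    (LieAlgebra.ad F (Derivation F (TruncatedPolynomial F p) (TruncatedPolynomial F p)) der) ^ p
        = 0 ∧
    ∀ E : Module.End F (Derivation F (TruncatedPolynomial F p) (TruncatedPolynomial F p)),
      E = ∑ k ∈ Finset.range p, ((k.factorial : F)⁻¹) •
            (LieAlgebra.ad F
              (Derivation F (TruncatedPolynomial F p) (TruncatedPolynomial F p)) der) ^ k →
      IsUnit E ∧
      ∃ u v : Derivation F (TruncatedPolynomial F p) (TruncatedPolynomial F p),
        E ⁅u, v⁆ ≠ ⁅E u, E v⁆ := by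
  have hnil := ad_pow_eq_zero hp.pos hder
  refine ⟨hnil, ?_⟩
  rintro E rfl
  refine ⟨?_, truncX F p ^ 2 • der, truncX F p ^ (p - 1) • der, ?_⟩
  · obtain ⟨m, hm⟩ := Nat.exists_eq_succ_of_ne_zero hp.ne_zero
    set N := LieAlgebra.ad F
      (Derivation F (TruncatedPolynomial F p) (TruncatedPolynomial F p)) der
    have hsum : IsNilpotent
        (∑ k ∈ Finset.range m, (((k + 1).factorial : F)⁻¹) • N ^ (k + 1)) := by
      refine Commute.isNilpotent_sum (fun k _ => ?_) fun i j _ _ => ?_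
      · exact (IsNilpotent.pow_of_pos ⟨p, hnil⟩ k.succ_ne_zero).smul _
      · exact ((Commute.pow_pow_self N _ _).smul_left _).smul_right _
    have hrange : Finset.range p = Finset.range (m + 1) := by rw [hm]
    rw [hrange, Finset.sum_range_succ', Nat.factorial_zero, Nat.cast_one, inv_one, one_smul,
      pow_zero]
    exact hsum.isUnit_add_one
  · have hder' : der (1 + truncX F p) = 1 := by
      rw [map_add, Derivation.map_one_eq_zero, zero_add, hder]
    have hzero : (0 : TruncatedPolynomial F p) • der = 0 :=
      Derivation.ext fun a => by
        rw [Derivation.smul_apply, smul_eq_mul, zero_mul, Derivation.zero_apply]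
    rw [sum_ad_pow_truncX_pow_smul hp hder (by lia), sum_ad_pow_truncX_pow_smul hp hder (by lia),
      lie_sq_smul_pow_pred_smul hp.two_le hder, lie_sq_smul_pow_pred_smul hp.two_le hder',
      truncX_pow_self, mul_zero, hzero, map_zero]
    have := nontrivial_of_ne_zero (F := F) hp.ne_zero
    have : CharP (TruncatedPolynomial F p) p :=
      charP_of_injective_algebraMap (algebraMap F _).injective p
    have : Fact p.Prime := ⟨hp⟩
    have hone : (1 + truncX F p) ^ p = 1 := by
      rw [add_pow_char, one_pow, truncX_pow_self, add_zero]
    intro h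
    have h3 := DFunLike.congr_fun h (truncX F p)
    rw [Derivation.smul_apply, hder, hone, Derivation.zero_apply, smul_eq_mul, mul_one, mul_one,
      eq_comm, neg_eq_zero] at h3
    have hdvd : p ∣ 3 :=
      (CharP.cast_eq_zero_iff (TruncatedPolynomial F p) p 3).mp (by exact_mod_cast h3)
    exact absurd (Nat.le_of_dvd (by norm_num) hdvd) hp3.not_ge
end
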